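/- arXiv:2504.12707 — 3 statements merged into one kernel-verified Lean document; each statement's English description precedes it below -/
import Mathlib

section
/- For every countable family (G_i)_{i∈ℕ} of finitely generated groups there exists a finitely generated simple group H such that every G_i admits an embedding into H that is simultaneously quasi-isometric and Frattini. -/
-- The sign (−1, 0, or 1) of a group element relative to the identity,
-- with respect to a linear order `l`.
open Classical in
noncomputable def orderSign {H : Type*} [Group H] (l : LinearOrder H) (h : H) : ℤ :=
  if l.lt h 1 then -1 else if h = 1 then 0 else 1

/-- A group is left-orderable if it carries a left-invariant linear order. -/
def IsLeftOrderable (G : Type*) [Group G] : Prop :=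
  ∃ l : LinearOrder G, ∀ a b c : G, l.le b c → l.le (a * b) (a * c)

/-- A Frattini embedding: an injective homomorphism preserving and reflecting conjugacy. -/
def IsFrattini {G H : Type*} [Group G] [Group H] (φ : G →* H) : Prop :=
  Function.Injective φ ∧ ∀ a b : G, IsConj a b ↔ IsConj (φ a) (φ b)

/-- `X` is a (finite) generating set of the group. -/
def Generates {G : Type*} [Group G] (X : Finset G) : Prop :=
  Subgroup.closure (X : Set G) = ⊤

/-- Word length of `g` with respect to the finite set `X`: the least length of a word
over `X ∪ X⁻¹` representing `g`. -/
noncomputable def wordLength {G : Type*} [Group G] (X : Finset G) (g : G) : ℕ :=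
  sInf {n | ∃ w : List G, w.length = n ∧ (∀ a ∈ w, a ∈ X ∨ a⁻¹ ∈ X) ∧ w.prod = g}

/-- Quasi-isometric embedding with respect to finite generating sets `X` and `Y`. -/
noncomputable def IsQIEmbedding {G H : Type*} [Group G] [Group H]
    (X : Finset G) (Y : Finset H) (φ : G →* H) : Prop :=
  Function.Injective φ ∧ ∃ C k : ℝ, 0 < C ∧ 0 < k ∧ ∀ g : G,
    (1 / C) * (wordLength X g : ℝ) - k ≤ (wordLength Y (φ g) : ℝ) ∧
    (wordLength Y (φ g) : ℝ) ≤ C * (wordLength X g : ℝ) + k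

/-- Evaluation of a formal word (list of pairs (index, sign)) over the
enumerated sequence `x : ℕ → G`. -/
def evalWord {G : Type*} [Group G] (x : ℕ → G) (w : List (ℕ × Bool)) : G :=
  (w.map (fun p => if p.2 then x p.1 else (x p.1)⁻¹)).prod

/-- A computable left order on a countable group with respect to an enumerated
generating sequence `x : ℕ → G`. -/
def ComputableLeftOrderWrt {G : Type*} [Group G] (x : ℕ → G) : Prop :=
  ∃ l : LinearOrder G, (∀ a b c : G, l.le b c → l.le (a * b) (a * c)) ∧
    Computable (fun w : List (ℕ × Bool) => orderSign l (evalWord x w))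

/-- A computable left order on a finitely generated group, presented by
a surjection `π` from a free group of finite rank. -/
def ComputableLeftOrderVia {H : Type*} [Group H] {m : ℕ}
    (π : FreeGroup (Fin m) →* H) : Prop :=
  ∃ l : LinearOrder H, (∀ a b c : H, l.le b c → l.le (a * b) (a * c)) ∧
    Computable (fun w : List (Fin m × Bool) => orderSign l (π (FreeGroup.mk w)))

/-- The embedding `φ` is computable: one can compute, for each `i`, a word over the
generators of `H` representing `φ (x i)`. -/
def ComputableEmbedding {G H : Type*} [Group G] [Group H] (x : ℕ → G) {m : ℕ}
    (π : FreeGroup (Fin m) →* H) (φ : G →* H) : Prop :=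
  ∃ f : ℕ → List (Fin m × Bool), Computable f ∧ ∀ i, π (FreeGroup.mk (f i)) = φ (x i)

/-- Decidable membership problem for the image of `φ` in `H`, presented via `π`. -/
def DecidableMembership {G H : Type*} [Group G] [Group H] {m : ℕ}
    (π : FreeGroup (Fin m) →* H) (φ : G →* H) : Prop :=
  ComputablePred (fun w : List (Fin m × Bool) => π (FreeGroup.mk w) ∈ φ.range)

/-- Decidable word problem for `H`, presented via `π`. -/
def DecidableWordProblemVia {H : Type*} [Group H] {m : ℕ}
    (π : FreeGroup (Fin m) →* H) : Prop :=
  ComputablePred (fun w : List (Fin m × Bool) => π (FreeGroup.mk w) = 1)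

/-- A group is finitely presented: quotient of a finite-rank free group by the
normal closure of finitely many relators. -/
def IsFinitelyPresented (K : Type*) [Group K] : Prop :=
  ∃ (m : ℕ) (π : FreeGroup (Fin m) →* K) (R : Finset (FreeGroup (Fin m))),
    Function.Surjective π ∧ π.ker = Subgroup.normalClosure (R : Set (FreeGroup (Fin m)))

namespace QF

/-! ### Word length -/

section WordLength

variable {G H : Type} [Group G] [Group H]

lemma wl_le (X : Finset G) (w : List G) (hw : ∀ a ∈ w, a ∈ X ∨ a⁻¹ ∈ X) :
    wordLength X w.prod ≤ w.length :=
  Nat.sInf_le ⟨w, rfl, hw, rfl⟩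

lemma wl_exists (X : Finset G) (hX : Generates X) (g : G) :
    ∃ w : List G, w.length = wordLength X g ∧ (∀ a ∈ w, a ∈ X ∨ a⁻¹ ∈ X) ∧ w.prod = g := by
  have hne : {n | ∃ w : List G, w.length = n ∧ (∀ a ∈ w, a ∈ X ∨ a⁻¹ ∈ X) ∧
      w.prod = g}.Nonempty := by
    have hg : g ∈ Subgroup.closure (X : Set G) := by
      rw [hX]; trivial
    rw [← Subgroup.mem_toSubmonoid, Subgroup.closure_toSubmonoid] at hg
    obtain ⟨l, hl, hp⟩ := Submonoid.exists_list_of_mem_closure hg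
    exact ⟨l.length, l, rfl, by simpa using hl, hp⟩
  exact Nat.sInf_mem hne

lemma wl_one (X : Finset G) : wordLength X (1 : G) = 0 := by
  have := wl_le X [] (by simp)
  simpa using this

lemma wl_mul (X : Finset G) (hX : Generates X) (a b : G) :
    wordLength X (a * b) ≤ wordLength X a + wordLength X b := by
  obtain ⟨u, hu, hu', rfl⟩ := wl_exists X hX a
  obtain ⟨v, hv, hv', rfl⟩ := wl_exists X hX b
  rw [← hu, ← hv, ← List.prod_append, ← List.length_append]
  apply wl_le
  intro a ha
  rcases List.mem_append.1 ha with h | h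
  · exact hu' a h
  · exact hv' a h

lemma wl_gen (X : Finset G) (x : G) (hx : x ∈ X ∨ x⁻¹ ∈ X) : wordLength X x ≤ 1 := by
  have := wl_le X [x] (by simpa using hx)
  simpa using this

lemma wl_inv (X : Finset G) (hX : Generates X) (a : G) :
    wordLength X a⁻¹ ≤ wordLength X a := by
  obtain ⟨u, hu, hu', rfl⟩ := wl_exists X hX a
  rw [← hu, List.prod_inv_reverse]
  refine (wl_le X _ ?_).trans (by simp)
  intro b hb
  simp only [List.mem_reverse, List.mem_map] at hb
  obtain ⟨c, hc, rfl⟩ := hb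
  rcases hu' c hc with h | h
  · right; simpa using h
  · left; exact h

/-- A subadditive family of bounds is linearly controlled by word length. -/
lemma lin_bound (Y : Finset H) (hY : Generates Y) (B : H → ℕ → Prop)
    (one : B 1 0) (mul : ∀ a b m n, B a m → B b n → B (a * b) (m + n))
    (mono : ∀ a m n, m ≤ n → B a m → B a n) (ex : ∀ a, ∃ m, B a m) :
    ∃ C : ℕ, ∀ h, B h (C * wordLength Y h) := by
  choose m hm using ex
  refine ⟨∑ y ∈ Y, (m y + m y⁻¹), fun h => ?_⟩
  obtain ⟨w, hw, hw', rfl⟩ := wl_exists Y hY h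
  rw [← hw]
  clear hw
  induction w with
  | nil => simpa using one
  | cons a w ih =>
    have h1 := ih (fun b hb => hw' b (List.mem_cons_of_mem _ hb))
    have h2 : B a (∑ y ∈ Y, (m y + m y⁻¹)) := by
      rcases hw' a (by simp) with h | h
      · refine mono _ _ _ ?_ (hm a)
        have := Finset.single_le_sum (f := fun y => m y + m y⁻¹) (fun _ _ => Nat.zero_le _) h
        omega
      · refine mono _ _ _ ?_ (hm a)
        have := Finset.single_le_sum (f := fun y => m y + m y⁻¹) (fun _ _ => Nat.zero_le _) h
        simp only [inv_inv] at this
        omega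
    rw [List.prod_cons]
    refine mono _ _ _ (le_of_eq ?_) (mul _ _ _ _ h2 h1)
    rw [List.length_cons]; ring

lemma upper_bd (φ : G →* H) (X : Finset G) (Y : Finset H) (hX : Generates X)
    (hY : Generates Y) : ∃ C : ℕ, ∀ g, wordLength Y (φ g) ≤ C * wordLength X g := by
  refine lin_bound X hX (fun g m => wordLength Y (φ g) ≤ m) ?_ ?_ ?_ ?_
  · simp [wl_one]
  · intro a b m n h1 h2
    rw [map_mul]
    exact (wl_mul Y hY _ _).trans (add_le_add h1 h2)
  · intro a m n h1 h2; exact h2.trans h1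
  · intro a; exact ⟨_, le_rfl⟩

/-- Linear lower bound for the distortion. -/
def LowerBd (φ : G →* H) : Prop :=
  ∀ (X : Finset G) (Y : Finset H), Generates X → Generates Y →
    ∃ C : ℕ, ∀ g, wordLength X g ≤ C * wordLength Y (φ g)

lemma qi_of_lower (φ : G →* H) (hφ : Function.Injective φ) (hl : LowerBd φ)
    (X : Finset G) (Y : Finset H) (hX : Generates X) (hY : Generates Y) :
    IsQIEmbedding X Y φ := by
  obtain ⟨C, hC⟩ := hl X Y hX hY
  obtain ⟨D, hD⟩ := upper_bd φ X Y hX hY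
  refine ⟨hφ, C + D + 1, 1, by positivity, by positivity, fun g => ⟨?_, ?_⟩⟩
  · have h1 : (wordLength X g : ℝ) ≤ C * wordLength Y (φ g) := by exact_mod_cast hC g
    have h2 : (1 / ((C : ℝ) + D + 1)) * (wordLength X g : ℝ) ≤ wordLength Y (φ g) := by
      rw [one_div, inv_mul_le_iff₀ (by positivity)]
      refine h1.trans ?_
      have : (0 : ℝ) ≤ (wordLength Y (φ g) : ℝ) := by positivity
      have : (0 : ℝ) ≤ (D : ℝ) := by positivity
      nlinarith
    linarith
  · have h1 : (wordLength Y (φ g) : ℝ) ≤ D * wordLength X g := by exact_mod_cast hD g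
    have : (0 : ℝ) ≤ (wordLength X g : ℝ) := by positivity
    have : (0 : ℝ) ≤ (C : ℝ) := by positivity
    nlinarith

lemma exists_gen (hG : Group.FG G) : ∃ X : Finset G, Generates X := by
  obtain ⟨X, hX⟩ := hG.out
  exact ⟨X, hX⟩

lemma LowerBd.comp {K : Type} [Group K] (hH : Group.FG H) {φ : G →* H} {ψ : H →* K}
    (h1 : LowerBd φ) (h2 : LowerBd ψ) : LowerBd (ψ.comp φ) := by
  intro X Z hX hZ
  obtain ⟨Y, hY⟩ := exists_gen hH
  obtain ⟨C, hC⟩ := h1 X Y hX hY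
  obtain ⟨D, hD⟩ := h2 Y Z hY hZ
  refine ⟨C * D, fun g => ?_⟩
  calc _ ≤ _ := hC g
    _ ≤ C * (D * _) := Nat.mul_le_mul_left _ (hD _)
    _ = _ := by rw [mul_assoc]; rfl

lemma frattini_comp {K : Type} [Group K] {φ : G →* H} {ψ : H →* K}
    (h1 : IsFrattini φ) (h2 : IsFrattini ψ) : IsFrattini (ψ.comp φ) :=
  ⟨h2.1.comp h1.1, fun a b => (h1.2 a b).trans (h2.2 _ _)⟩

lemma frattini_of (φ : G →* H) (hi : Function.Injective φ)
    (h : ∀ a b : G, ∀ k : H, k * φ a * k⁻¹ = φ b → IsConj a b) : IsFrattini φ := by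
  refine ⟨hi, fun a b => ⟨fun hab => φ.map_isConj hab, fun hab => ?_⟩⟩
  obtain ⟨k, hk⟩ := isConj_iff.1 hab
  exact h a b k hk

end WordLength

/-! ### Step 1: a countable family embeds into one finitely generated group -/

section Family

abbrev Pos := ℤ × ℤ

/-- Labels acting on `Pos × P`. -/
def lab (P : Type) [Group P] : (Pos → P) →* Equiv.Perm (Pos × P) where
  toFun f :=
    { toFun := fun z => (z.1, f z.1 * z.2)
      invFun := fun z => (z.1, (f z.1)⁻¹ * z.2)
      left_inv := fun z => by simp
      right_inv := fun z => by simp }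
  map_one' := by ext z <;> simp
  map_mul' f g := by ext z <;> simp [mul_assoc]

/-- Permutations of positions acting on `Pos × P`. -/
def mv (P : Type) : Equiv.Perm Pos →* Equiv.Perm (Pos × P) where
  toFun π :=
    { toFun := fun z => (π z.1, z.2)
      invFun := fun z => (π⁻¹ z.1, z.2)
      left_inv := fun z => by simp
      right_inv := fun z => by simp }
  map_one' := by ext z <;> simp
  map_mul' f g := by ext z <;> simp

lemma mv_lab (P : Type) [Group P] (π : Equiv.Perm Pos) (f : Pos → P) :
    mv P π * lab P f * (mv P π)⁻¹ = lab P (fun z => f (π⁻¹ z)) := by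
  rw [mul_inv_eq_iff_eq_mul]
  ext z <;> simp [mv, lab]

/-- vertical shift -/
def vs (k : ℤ) : Equiv.Perm Pos where
  toFun z := (z.1, z.2 + k)
  invFun z := (z.1, z.2 - k)
  left_inv z := by simp
  right_inv z := by simp

/-- horizontal shift of the zeroth row -/
def hs : Equiv.Perm Pos where
  toFun z := if z.2 = 0 then (z.1 + 1, z.2) else z
  invFun z := if z.2 = 0 then (z.1 - 1, z.2) else z
  left_inv z := by
    by_cases h : z.2 = 0 <;> simp [h]
    ext <;> simp [h]
  right_inv z := by
    by_cases h : z.2 = 0 <;> simp [h]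
    ext <;> simp [h]

/-- The label function of the third generator. -/
def labF {P : Type} [Group P] (x : ℤ → P) : Pos → P := fun z => if 0 ≤ z.1 then x z.2 else 1

/-- The finitely generated group. -/
def KK {P : Type} [Group P] (x : ℤ → P) : Subgroup (Equiv.Perm (Pos × P)) :=
  Subgroup.closure {lab P (labF x), mv P (vs 1), mv P hs}

/-- The embedding of `P` by a label at the origin. -/
def del (P : Type) [Group P] : P →* Equiv.Perm (Pos × P) :=
  (lab P).comp (MonoidHom.mulSingle (fun _ : Pos => P) (0, 0))

variable {P : Type} [Group P] (x : ℤ → P)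

lemma vs_mem (k : ℤ) : mv P (vs k) ∈ KK x := by
  have h1 : mv P (vs 1) ∈ KK x := Subgroup.subset_closure (by simp)
  have : vs k = (vs 1) ^ k := by
    induction k using Int.induction_on with
    | zero => ext z <;> simp [vs]
    | succ i ih =>
      rw [zpow_add_one, ← ih]; ext z <;> simp [vs]; ring
    | pred i ih =>
      rw [zpow_sub_one, ← ih, eq_mul_inv_iff_mul_eq]; ext z <;> simp [vs]
  rw [this, map_zpow]
  exact Subgroup.zpow_mem _ h1 k

lemma del_mem (k : ℤ) : del P (x k) ∈ KK x := by
  have h1 : lab P (labF x) ∈ KK x := Subgroup.subset_closure (by simp)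
  have h2 : mv P hs ∈ KK x := Subgroup.subset_closure (by simp)
  have h3 := vs_mem x k
  have h4 := vs_mem x (-k)
  set π : Equiv.Perm Pos := vs k * hs * (vs k)⁻¹ with hπ
  have h5 : mv P π ∈ KK x := by
    rw [hπ, map_mul, map_mul, map_inv]
    exact mul_mem (mul_mem h3 h2) (inv_mem h3)
  have h6 : mv P (vs (-k)) * (lab P (labF x) * (mv P π * lab P (labF x)⁻¹ * (mv P π)⁻¹)) *
      (mv P (vs (-k)))⁻¹ ∈ KK x := by
    refine mul_mem (mul_mem h4 (mul_mem h1 (mul_mem (mul_mem h5 ?_) (inv_mem h5)))) (inv_mem h4)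
    rw [map_inv]; exact inv_mem h1
  convert h6
  rw [mv_lab, ← map_mul, mv_lab, del, MonoidHom.comp_apply]
  congr 1
  funext z
  obtain ⟨n, m⟩ := z
  have e1 : (vs (-k))⁻¹ (n, m) = (n, m + k) := by
    rw [Equiv.Perm.inv_eq_iff_eq]; simp [vs]
  have e2 : π⁻¹ (n, m + k) = if m = 0 then (n - 1, m + k) else (n, m + k) := by
    rw [Equiv.Perm.inv_eq_iff_eq, hπ]
    have e3 : ∀ a b, (vs k)⁻¹ (a, b) = (a, b - k) := by
      intro a b; rw [Equiv.Perm.inv_eq_iff_eq]; simp [vs]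
    by_cases hm : m = 0
    · simp [hm, e3, hs, vs]
    · simp [hm, e3, hs, vs]
  simp only [e1, Pi.mul_apply, Pi.inv_apply, e2, MonoidHom.mulSingle_apply]
  by_cases hm : m = 0
  · subst hm
    by_cases hn : n = 0
    · subst hn; simp [labF]
    · have : ((n, 0) : Pos) ≠ (0, 0) := by simp [hn]
      rw [Pi.mulSingle_eq_of_ne this]
      simp only [labF]
      by_cases h0 : 0 ≤ n
      · have : 1 ≤ n := by omega
        simp [h0, this]
      · have : ¬ 1 ≤ n := by omega
        simp [h0, this]
  · have : ((n, m) : Pos) ≠ (0, 0) := by simp [hm]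
    rw [Pi.mulSingle_eq_of_ne this]
    simp [labF, hm]

lemma KK_fg : Group.FG (KK x) := by
  rw [Group.fg_iff_subgroup_fg, Subgroup.fg_iff]
  exact ⟨_, rfl, by simp⟩

/-- `BB ℓ h M`: all labels of `h` have `ℓ`-length at most `M`. -/
def BB (l : P → ℕ) (h : Equiv.Perm (Pos × P)) (M : ℕ) : Prop :=
  ∀ z, ∃ z' g, (∀ p, h (z, p) = (z', g * p)) ∧ l g ≤ M

lemma BB_mul (l : P → ℕ) (hl : ∀ a b, l (a * b) ≤ l a + l b) (h k : Equiv.Perm (Pos × P))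
    (m n : ℕ) (h1 : BB l h m) (h2 : BB l k n) : BB l (h * k) (m + n) := by
  intro z
  obtain ⟨z', g, hg, hg'⟩ := h2 z
  obtain ⟨z'', g2, hg2, hg2'⟩ := h1 z'
  refine ⟨z'', g2 * g, fun p => ?_, (hl _ _).trans (add_le_add hg2' hg')⟩
  rw [Equiv.Perm.mul_apply, hg, hg2, mul_assoc]

lemma BB_ex (l : P → ℕ) (hl : ∀ a b, l (a * b) ≤ l a + l b) (hl1 : l 1 = 0)
    (hx : ∀ k, l (x k) ≤ 1) (hx' : ∀ k, l (x k)⁻¹ ≤ 1) (h) (hh : h ∈ KK x) : ∃ M, BB l h M := by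
  have hlab : ∀ f : Pos → P, (∀ z, l (f z) ≤ 1) → BB l (lab P f) 1 :=
    fun f hf z => ⟨z, f z, fun p => rfl, hf z⟩
  have hmv : ∀ π, BB l (mv P π) 0 :=
    fun π z => ⟨π z, 1, fun p => by simp [mv], hl1.le⟩
  induction hh using Subgroup.closure_induction'' with
  | mem h hh =>
    simp only [Set.mem_insert_iff, Set.mem_singleton_iff] at hh
    rcases hh with rfl | rfl | rfl
    · refine ⟨1, hlab _ fun z => ?_⟩
      unfold labF; split_ifs
      · exact hx _
      · omega
    · exact ⟨0, hmv _⟩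
    · exact ⟨0, hmv _⟩
  | inv_mem h hh =>
    simp only [Set.mem_insert_iff, Set.mem_singleton_iff] at hh
    rcases hh with rfl | rfl | rfl
    · rw [← map_inv]
      refine ⟨1, hlab _ fun z => ?_⟩
      rw [Pi.inv_apply]
      unfold labF; split_ifs
      · exact hx' _
      · rw [inv_one]; omega
    · rw [← map_inv]; exact ⟨0, hmv _⟩
    · rw [← map_inv]; exact ⟨0, hmv _⟩
  | one => exact ⟨0, fun z => ⟨z, 1, fun p => by simp, hl1.le⟩⟩
  | mul a b _ _ ha hb =>
    obtain ⟨m, hm⟩ := ha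
    obtain ⟨n, hn⟩ := hb
    exact ⟨_, BB_mul l hl a b m n hm hn⟩

lemma del_apply (a : P) (z : Pos) (p : P) :
    del P a (z, p) = (z, (if z = (0, 0) then a else 1) * p) := by
  simp only [del, MonoidHom.comp_apply, lab, MonoidHom.mulSingle_apply, MonoidHom.coe_mk,
    OneHom.coe_mk, Equiv.coe_fn_mk, Pi.mulSingle_apply]

lemma del_inj : Function.Injective (del P) := by
  intro a b h
  have := congrArg (fun f => (f ((0, 0), 1)).2) h
  simpa [del_apply] using this

lemma del_conj (a b : P) (h) (hh : h ∈ KK x) (hc : h * del P a * h⁻¹ = del P b) : IsConj a b := by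
  obtain ⟨M, hM⟩ := BB_ex x (fun _ => 0) (by simp) rfl (by simp) (by simp) h hh
  obtain ⟨z, g, hg, -⟩ := hM (0, 0)
  have hc1 : h * del P a = del P b * h := by rw [← hc]; group
  have := congrArg (fun f => f ((0, 0), 1)) hc1
  simp only [Equiv.Perm.mul_apply, del_apply, hg, if_true, mul_one] at this
  have h2 := (Prod.mk.inj this).2
  by_cases hz : z = (0, 0)
  · rw [if_pos hz] at h2
    exact isConj_iff.2 ⟨g, by rw [h2]; group⟩
  · rw [if_neg hz] at h2
    have ha : a = 1 := by simpa using h2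
    have hb : del P b = 1 := by rw [← hc, ha]; simp
    have hb' : b = 1 := del_inj (by rw [hb, map_one])
    rw [ha, hb']

theorem family_step (G : ℕ → Type) [∀ i, Group (G i)] (hfg : ∀ i, Group.FG (G i)) :
    ∃ (K : Type) (_ : Group K), Group.FG K ∧
      ∀ i, ∃ φ : G i →* K, LowerBd φ ∧ IsFrattini φ := by
  choose X hX using fun i => exists_gen (hfg i)
  classical
  let ι := Option (Σ i, X i)
  obtain ⟨e, he⟩ := exists_surjective_nat ι
  let y : ι → (∀ i, G i) := fun o => match o with
    | none => 1
    | some ⟨i, a⟩ => Pi.mulSingle i (a : G i)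
  let x : ℤ → (∀ i, G i) := fun k => y (e k.toNat)
  have hxs : ∀ i, ∀ a ∈ X i, ∃ k, x k = Pi.mulSingle i a := by
    intro i a ha
    obtain ⟨n, hn⟩ := he (some ⟨i, ⟨a, ha⟩⟩)
    exact ⟨n, by simp [x, hn, y]⟩
  have hxg : ∀ i k, x k i = 1 ∨ x k i ∈ X i := by
    intro i k
    simp only [x]
    rcases e k.toNat with _ | ⟨j, a⟩
    · left; rfl
    · simp only [y]
      by_cases hij : i = j
      · subst hij; right; simp
      · left; rw [Pi.mulSingle_eq_of_ne hij]
  refine ⟨KK x, inferInstance, KK_fg x, fun i => ?_⟩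
  have hmem : ∀ a : G i, (del (∀ i, G i)) (Pi.mulSingle i a) ∈ KK x := by
    intro a
    have ha : a ∈ Subgroup.closure (X i : Set (G i)) := by rw [hX i]; trivial
    have : Subgroup.closure (X i : Set (G i)) ≤
        (KK x).comap ((del (∀ i, G i)).comp (MonoidHom.mulSingle G i)) := by
      rw [Subgroup.closure_le]
      intro a ha
      obtain ⟨k, hk⟩ := hxs i a ha
      have := del_mem x k
      rw [hk] at this
      exact this
    exact this ha
  let φ : G i →* KK x :=
    ((del (∀ i, G i)).comp (MonoidHom.mulSingle G i)).codRestrict (KK x) hmem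
  have hφ : ∀ a, ((φ a : KK x) : Equiv.Perm _) = del (∀ i, G i) (Pi.mulSingle i a) := fun a => rfl
  refine ⟨φ, ?_, frattini_of φ ?_ ?_⟩
  · intro X' Y hX' hY
    have hXX : ∃ C : ℕ, ∀ g, wordLength X' g ≤ C * wordLength (X i) g :=
      upper_bd (MonoidHom.id (G i)) (X i) X' (hX i) hX'
    obtain ⟨D, hD⟩ := hXX
    let l : (∀ i, G i) → ℕ := fun p => wordLength (X i) (p i)
    have hl : ∀ a b, l (a * b) ≤ l a + l b := fun a b => wl_mul _ (hX i) _ _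
    have hl1 : l 1 = 0 := wl_one _
    have hx1 : ∀ k, l (x k) ≤ 1 := by
      intro k
      rcases hxg i k with h | h
      · simp only [l]; rw [h, wl_one]; omega
      · exact wl_gen _ _ (Or.inl h)
    obtain ⟨C, hC⟩ := lin_bound Y hY (fun (h : KK x) m => BB l h m)
      (fun z => ⟨z, 1, fun p => by simp, hl1.le⟩)
      (fun a b m n h1 h2 => BB_mul l hl _ _ m n h1 h2)
      (fun a m n hmn h1 z => by
        obtain ⟨z', g, h3, h4⟩ := h1 z
        exact ⟨z', g, h3, h4.trans hmn⟩)
      (fun a => BB_ex x l hl hl1 hx1 (fun k => (wl_inv _ (hX i) _).trans (hx1 k)) _ a.2)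
    refine ⟨D * C, fun a => (hD a).trans ?_⟩
    rw [mul_assoc]
    refine Nat.mul_le_mul_left _ ?_
    obtain ⟨z', g, h3, h4⟩ := hC (φ a) (0, 0)
    have h5 := h3 1
    rw [hφ, del_apply] at h5
    have h6 := (Prod.mk.inj h5).2
    simp only [if_true, mul_one] at h6
    rw [← h6] at h4
    simpa [l] using h4
  · intro a b hab
    have := congrArg (fun z : KK x => (z : Equiv.Perm (Pos × (∀ i, G i)))) hab
    simp only [hφ] at this
    exact Pi.mulSingle_injective i (del_inj this)
  · intro a b k hk
    have := congrArg (fun z : KK x => (z : Equiv.Perm (Pos × (∀ i, G i)))) hk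
    simp only [Subgroup.coe_mul, Subgroup.coe_inv, hφ] at this
    have h2 := del_conj x _ _ _ k.2 this
    simpa using (Pi.evalMonoidHom G i).map_isConj h2

end Family

/-! ### Step 2: embedding a finitely generated group into a finitely generated simple group -/

section Simple

/-- The alphabet. -/
def E (G : Type) : Type := Option G × ℕ

/-- Letters. -/
def mkE {G : Type} (b : Option G) (n : ℕ) : E G := (b, n)

instance (G : Type) [Group G] : MulAction G (E G) where
  smul g e := (e.1.map (fun a => g * a), e.2)
  one_smul e := by
    rcases e with ⟨_ | a, n⟩
    · rfl
    · exact congrArg (fun t => ((some t, n) : E G)) (one_mul a)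
  mul_smul g h e := by
    rcases e with ⟨_ | a, n⟩
    · rfl
    · exact congrArg (fun t => ((some t, n) : E G)) (mul_assoc g h a)

/-- Infinite sequences over the alphabet. -/
abbrev S (G : Type) : Type := ℕ → E G

/-- The space on which the simple group acts. -/
abbrev XX (G : Type) : Type := Fin 9 × S G

set_option linter.unusedSectionVars false

variable {G : Type} [Group G]

lemma smul_snd (g : G) (e : E G) : (g • e).2 = e.2 := rfl

lemma smul_none (g : G) (n : ℕ) : g • (mkE none n : E G) = mkE none n := rfl

lemma smul_some (g a : G) (n : ℕ) : g • (mkE (some a) n : E G) = mkE (some (g * a)) n := rfl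

/-- Prepend a letter. -/
def cons (e : E G) (x : S G) : S G
  | 0 => e
  | n + 1 => x n

@[simp] lemma cons_zero (e : E G) (x : S G) : cons e x 0 = e := rfl
@[simp] lemma cons_succ (e : E G) (x : S G) (n : ℕ) : cons e x (n + 1) = x n := rfl

lemma cons_eta (x : S G) : cons (x 0) (fun i => x (i + 1)) = x := by
  funext i; cases i <;> rfl

/-- Recode the first letter. -/
def uS (e : Bool) (x : S G) : S G
  | 0 => mkE (x 0).1 (2 * (x 0).2 + (if e then 1 else 0))
  | n + 1 => x (n + 1)

/-- Index type of the elementary maps. -/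
abbrev Q : Type := Option (Bool ⊕ Bool × Fin 5)

/-- The elementary maps. -/
def qm : Q → S G → S G
  | none, x => x
  | some (Sum.inl e), x => uS e x
  | some (Sum.inr c), x => cons (mkE (if c.1 then some 1 else none) c.2) x

/-- Agreement of the first `n` letters. -/
def agree (n : ℕ) (x y : S G) : Prop := ∀ i < n, x i = y i

lemma uS_zero (e : Bool) (x : S G) :
    uS e x 0 = mkE (x 0).1 (2 * (x 0).2 + (if e then 1 else 0)) := rfl

lemma uS_succ (e : Bool) (x : S G) (n : ℕ) : uS e x (n + 1) = x (n + 1) := rfl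

lemma uS_zero_inj (e : Bool) (x y : S G) (h : uS e x 0 = uS e y 0) : x 0 = y 0 := by
  rw [uS_zero, uS_zero] at h
  have h1 := congrArg Prod.fst h
  have h2 := congrArg Prod.snd h
  simp only [mkE] at h1 h2
  exact Prod.ext h1 (by omega)

lemma qm_inj (q : Q) : Function.Injective (qm q : S G → S G) := by
  intro x y h
  rcases q with _ | e | c
  · exact h
  · funext i
    have h' : uS e x = uS e y := h
    cases i with
    | zero => exact uS_zero_inj e x y (congrFun h' 0)
    | succ n => exact congrFun h' (n + 1)
  · funext i
    exact congrFun h (i + 1)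

lemma qm_agree (q : Q) (n : ℕ) (x y : S G) (h : agree n x y) : agree n (qm q x) (qm q y) := by
  intro i hi
  rcases q with _ | e | c
  · exact h i hi
  · cases i with
    | zero => change uS e x 0 = uS e y 0; rw [uS_zero, uS_zero, h 0 hi]
    | succ n => exact h _ hi
  · cases i with
    | zero => rfl
    | succ m => exact h m (by omega)

lemma qm_open (q : Q) (n : ℕ) (x y' : S G) (h : agree (n + 1) (qm q x) y') :
    ∃ y, qm q y = y' ∧ agree n x y := by
  rcases q with _ | e | c
  · exact ⟨y', rfl, fun i hi => h i (by omega)⟩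
  · refine ⟨cons (x 0) (fun i => y' (i + 1)), ?_, ?_⟩
    · funext i
      cases i with
      | zero => exact h 0 (by omega)
      | succ m => rfl
    · intro i hi
      cases i with
      | zero => rfl
      | succ m => exact h (m + 1) (by omega)
  · refine ⟨fun i => y' (i + 1), ?_, ?_⟩
    · funext i
      cases i with
      | zero => exact h 0 (by omega)
      | succ m => rfl
    · intro i hi
      exact h (i + 1) (by omega)

lemma qm_shift (q : Q) : ∃ r : ℕ, ∀ (x : S G) (j : ℕ), qm q x (r + 1 + j) = x (1 + j) := by
  rcases q with _ | e | c
  · exact ⟨0, fun x j => by simp [qm]⟩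
  · refine ⟨0, fun x j => ?_⟩
    rw [add_comm 1 j]
    rfl
  · refine ⟨1, fun x j => ?_⟩
    have : 1 + 1 + j = (1 + j) + 1 := by omega
    rw [this]
    rfl

/-- The map used at coordinate `j`. -/
def qj (q : Q) (j : Fin 5) : Q := if j = 0 then none else q

/-- The embeddings of five copies of the sequence space. -/
def emb5 (p : Fin 5 ↪ Fin 9) (q : Q) : S G × Fin 5 ↪ XX G where
  toFun t := (p t.2, qm (qj q t.2) t.1)
  inj' := by
    rintro ⟨x, j⟩ ⟨y, k⟩ h
    have h1 := p.injective (congrArg Prod.fst h)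
    have h2 := congrArg Prod.snd h
    simp only at h1 h2
    subst h1
    rw [qm_inj _ h2]

/-- Permutations of `Fin 5` acting on the second coordinate. -/
def fib : Equiv.Perm (Fin 5) →* Equiv.Perm (S G × Fin 5) where
  toFun α := Equiv.prodCongr (Equiv.refl _) α
  map_one' := rfl
  map_mul' _ _ := rfl

/-- The basic homomorphisms. -/
noncomputable def ih (p : Fin 5 ↪ Fin 9) (q : Q) : Equiv.Perm (Fin 5) →* Equiv.Perm (XX G) :=
  (Equiv.Perm.viaEmbeddingHom (emb5 p q)).comp fib

lemma ih_apply (p : Fin 5 ↪ Fin 9) (q : Q) (α : Equiv.Perm (Fin 5)) (j : Fin 5) (x : S G) :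
    ih p q α (p j, qm (qj q j) x) = (p (α j), qm (qj q (α j)) x) :=
  Equiv.Perm.viaEmbedding_apply (fib α) (emb5 p q) (x, j)

lemma ih_out (p : Fin 5 ↪ Fin 9) (q : Q) (α : Equiv.Perm (Fin 5)) (z : XX G)
    (hz : ∀ j x, z ≠ (p j, qm (qj q j) x)) : ih p q α z = z := by
  refine Equiv.Perm.viaEmbedding_apply_of_notMem (fib α) (emb5 p q) z ?_
  rintro ⟨⟨x, j⟩, h⟩
  exact hz j x h.symm

/-- The action of the given group on the zeroth copy. -/
def g0 : G →* Equiv.Perm (XX G) where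
  toFun g :=
    { toFun := fun z => if z.1 = 0 then (z.1, g • z.2) else z
      invFun := fun z => if z.1 = 0 then (z.1, g⁻¹ • z.2) else z
      left_inv := by
        rintro ⟨l, x⟩
        by_cases h : l = 0 <;> simp [h]
      right_inv := by
        rintro ⟨l, x⟩
        by_cases h : l = 0 <;> simp [h] }
  map_one' := by
    ext1 ⟨l, x⟩
    by_cases h : l = 0 <;> simp [h]
  map_mul' a b := by
    ext1 ⟨l, x⟩
    by_cases h : l = 0 <;> simp [h, mul_smul]

lemma g0_zero (g : G) (x : S G) : g0 g (0, x) = (0, g • x) := rfl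

lemma g0_ne (g : G) (l : Fin 9) (x : S G) (hl : l ≠ 0) : g0 g (l, x) = (l, x) := if_neg hl

/-- The generators. -/
def gens (G : Type) [Group G] : Set (Equiv.Perm (XX G)) :=
  {h | ∃ p q, ∃ α ∈ alternatingGroup (Fin 5), h = ih p q α} ∪ Set.range g0

/-- The simple group. -/
def HH (G : Type) [Group G] : Subgroup (Equiv.Perm (XX G)) := Subgroup.closure (gens G)

lemma ih_mem (p : Fin 5 ↪ Fin 9) (q : Q) (α : Equiv.Perm (Fin 5))
    (hα : α ∈ alternatingGroup (Fin 5)) : (ih p q α : Equiv.Perm (XX G)) ∈ HH G :=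
  Subgroup.subset_closure (Or.inl ⟨p, q, α, hα, rfl⟩)

lemma g0_mem (g : G) : (g0 g : Equiv.Perm (XX G)) ∈ HH G :=
  Subgroup.subset_closure (Or.inr ⟨g, rfl⟩)

lemma gens_inv (h : Equiv.Perm (XX G)) (hh : h ∈ gens G) : h⁻¹ ∈ gens G := by
  rcases hh with ⟨p, q, α, hα, rfl⟩ | ⟨g, rfl⟩
  · exact Or.inl ⟨p, q, α⁻¹, inv_mem hα, by simp⟩
  · exact Or.inr ⟨g⁻¹, by simp⟩

lemma HH_fg (hG : Group.FG G) : Group.FG (HH G) := by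
  obtain ⟨X, hX⟩ := exists_gen hG
  rw [Group.fg_iff_subgroup_fg, Subgroup.fg_iff]
  refine ⟨{h | ∃ p q, ∃ α ∈ alternatingGroup (Fin 5), h = ih p q α} ∪ Set.image g0 (X : Set G),
    le_antisymm (Subgroup.closure_mono ?_) ?_, ?_⟩
  · exact Set.union_subset_union_right _ (Set.image_subset_range _ _)
  · rw [HH, Subgroup.closure_le]
    rintro h (hh | ⟨g, rfl⟩)
    · exact Subgroup.subset_closure (Or.inl hh)
    · have : (⊤ : Subgroup G) ≤ (Subgroup.closure ({h | ∃ p q, ∃ α ∈ alternatingGroup (Fin 5),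
          h = ih p q α} ∪ Set.image g0 (X : Set G))).comap g0 := by
        rw [← hX, Subgroup.closure_le]
        intro g hg
        exact Subgroup.subset_closure (Or.inr ⟨g, hg, rfl⟩)
      exact this (Subgroup.mem_top g)
  · refine Set.Finite.union ?_ (X.finite_toSet.image _)
    refine (Set.finite_range (fun t : (Fin 5 ↪ Fin 9) × Q × Equiv.Perm (Fin 5) =>
      (ih t.1 t.2.1 t.2.2 : Equiv.Perm (XX G)))).subset ?_
    rintro h ⟨p, q, α, -, rfl⟩
    exact ⟨(p, q, α), rfl⟩

/-! Continuity and labels. -/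

/-- Agreement in the space `XX`. -/
def agX (n : ℕ) (z z' : XX G) : Prop := z.1 = z'.1 ∧ agree n z.2 z'.2

lemma agX.mono {n m : ℕ} {z z' : XX G} (h : agX m z z') (hnm : n ≤ m) : agX n z z' :=
  ⟨h.1, fun i hi => h.2 i (by omega)⟩

lemma agX_refl (n : ℕ) (z : XX G) : agX n z z := ⟨rfl, fun _ _ => rfl⟩

/-- Continuity. -/
def Cont (h : Equiv.Perm (XX G)) : Prop :=
  ∀ z n, ∃ m, ∀ z', agX m z z' → agX n (h z) (h z')

/-- The germ of `h` at `z` acts on tails as `g`. -/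
def Label (h : Equiv.Perm (XX G)) (z : XX G) (g : G) : Prop :=
  ∃ N M : ℕ, ∀ z', agX N z z' → ∀ j, (h z').2 (M + j) = g • z'.2 (N + j)

lemma emb5_out (p : Fin 5 ↪ Fin 9) (q : Q) (n : ℕ) (z z' : XX G) (h : agX (n + 1) z z')
    (hz : ∀ j x, z ≠ (p j, qm (qj q j) x)) : ∀ j x, z' ≠ (p j, qm (qj q j) x) := by
  rintro j x rfl
  obtain ⟨y, hy, -⟩ := qm_open (qj q j) n x z.2 (fun i hi => (h.2 i hi).symm)
  exact hz j y (Prod.ext h.1 hy.symm)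

lemma emb5_in (p : Fin 5 ↪ Fin 9) (q : Q) (n : ℕ) (j : Fin 5) (x : S G) (z' : XX G)
    (h : agX (n + 1) (p j, qm (qj q j) x) z') :
    ∃ y, z' = (p j, qm (qj q j) y) ∧ agree n x y := by
  obtain ⟨y, hy, hxy⟩ := qm_open (qj q j) n x z'.2 h.2
  exact ⟨y, Prod.ext h.1.symm hy.symm, hxy⟩

lemma cont_ih (p : Fin 5 ↪ Fin 9) (q : Q) (α : Equiv.Perm (Fin 5)) :
    Cont (ih p q α : Equiv.Perm (XX G)) := by
  intro z n
  refine ⟨n + 1, fun z' h => ?_⟩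
  by_cases hz : ∀ j x, z ≠ (p j, qm (qj q j) x)
  · rw [ih_out p q α z hz, ih_out p q α z' (emb5_out p q n z z' h hz)]
    exact h.mono (by omega)
  · push Not at hz
    obtain ⟨j, x, rfl⟩ := hz
    obtain ⟨y, rfl, hy⟩ := emb5_in p q n j x z' h
    rw [ih_apply, ih_apply]
    exact ⟨rfl, qm_agree _ _ _ _ hy⟩

lemma label_ih (p : Fin 5 ↪ Fin 9) (q : Q) (α : Equiv.Perm (Fin 5)) (z : XX G) :
    Label (ih p q α : Equiv.Perm (XX G)) z 1 := by
  by_cases hz : ∀ j x, z ≠ (p j, qm (qj q j) x)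
  · refine ⟨1, 1, fun z' h j => ?_⟩
    rw [ih_out p q α z' (emb5_out p q 0 z z' h hz), one_smul]
  · push Not at hz
    obtain ⟨j, x, rfl⟩ := hz
    obtain ⟨r, hr⟩ := qm_shift (G := G) (qj q j)
    obtain ⟨s, hs⟩ := qm_shift (G := G) (qj q (α j))
    refine ⟨r + 1, s + 1, fun z' h i => ?_⟩
    obtain ⟨y, rfl, -⟩ := emb5_in p q r j x z' h
    rw [ih_apply, one_smul]
    simp only
    rw [hr, hs]

lemma cont_g0 (g : G) : Cont (g0 g) := by
  rintro ⟨l, x⟩ n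
  refine ⟨n, ?_⟩
  rintro ⟨l', x'⟩ ⟨h1, h2⟩
  simp only at h1
  subst h1
  by_cases hl : l = 0
  · subst hl
    rw [g0_zero, g0_zero]
    refine ⟨rfl, fun i hi => ?_⟩
    exact congrArg (g • ·) (h2 i hi)
  · rw [g0_ne g l x hl, g0_ne g l x' hl]
    exact ⟨rfl, h2⟩

lemma label_g0_zero (g : G) (x : S G) : Label (g0 g) (0, x) g := by
  refine ⟨0, 0, ?_⟩
  rintro ⟨l', x'⟩ ⟨h1, -⟩ j
  simp only at h1
  subst h1
  rfl

lemma label_g0_ne (g : G) (l : Fin 9) (x : S G) (hl : l ≠ 0) : Label (g0 g) (l, x) 1 := by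
  refine ⟨0, 0, ?_⟩
  rintro ⟨l', x'⟩ ⟨h1, -⟩ j
  simp only at h1
  subst h1
  rw [g0_ne g l x' hl, one_smul]

lemma cont_mul {h k : Equiv.Perm (XX G)} (hh : Cont h) (hk : Cont k) : Cont (h * k) := by
  intro z n
  obtain ⟨m, hm⟩ := hh (k z) n
  obtain ⟨m', hm'⟩ := hk z m
  exact ⟨m', fun z' hz => hm _ (hm' _ hz)⟩

lemma cont_one : Cont (1 : Equiv.Perm (XX G)) := fun _ n => ⟨n, fun _ h => h⟩

lemma label_one (z : XX G) : Label 1 z 1 :=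
  ⟨0, 0, fun z' _ j => by simp⟩

lemma label_mul {h k : Equiv.Perm (XX G)} {z : XX G} {a b : G} (hk : Cont k)
    (h1 : Label h (k z) a) (h2 : Label k z b) : Label (h * k) z (a * b) := by
  obtain ⟨N1, M1, h1⟩ := h1
  obtain ⟨N2, M2, h2⟩ := h2
  obtain ⟨K, hK⟩ := hk z N1
  refine ⟨N2 + (N1 + K), M1 + (M2 + K), fun z' hz j => ?_⟩
  have e1 := h1 (k z') (hK z' (hz.mono (by omega))) (M2 + K + j)
  have e2 := h2 z' (hz.mono (by omega)) (N1 + K + j)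
  rw [Equiv.Perm.mul_apply, mul_smul, show M1 + (M2 + K) + j = M1 + (M2 + K + j) by omega, show N2 + (N1 + K) + j = N2 + (N1 + K + j) by omega,
    ← e2, show M2 + (N1 + K + j) = N1 + (M2 + K + j) by omega, ← e1]

lemma label_unique_aux {h : Equiv.Perm (XX G)} {z : XX G} {a b : G} {N M d : ℕ}
    (h1 : ∀ z', agX N z z' → ∀ j, (h z').2 (M + j) = a • z'.2 (N + j))
    (h2 : ∀ z', agX N z z' → ∀ j, (h z').2 (M + d + j) = b • z'.2 (N + j)) : a = b := by
  let z' : XX G := (z.1, fun i => if i < N then z.2 i else if i = N then mkE (some 1) 0 else mkE none 1)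
  have hz : agX N z z' := ⟨rfl, fun i hi => by simp [z', hi]⟩
  have e1 := h1 z' hz d
  have e2 := h2 z' hz 0
  rw [add_zero, e1] at e2
  have hN : z'.2 (N + 0) = (mkE (some 1) 0 : E G) := by simp [z']
  rw [hN] at e2
  by_cases hd : d = 0
  · subst hd
    rw [hN, smul_some, smul_some] at e2
    have := congrArg Prod.fst e2
    simpa [mkE] using this
  · have hd' : z'.2 (N + d) = (mkE none 1 : E G) := by simp [z', hd]
    rw [hd', smul_none, smul_some] at e2
    have := congrArg Prod.snd e2
    simp [mkE] at this

lemma label_unique {h : Equiv.Perm (XX G)} {z : XX G} {a b : G}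
    (h1 : Label h z a) (h2 : Label h z b) : a = b := by
  obtain ⟨N1, M1, h1⟩ := h1
  obtain ⟨N2, M2, h2⟩ := h2
  have k1 : ∀ z', agX (N1 + N2) z z' → ∀ j, (h z').2 (M1 + N2 + j) = a • z'.2 (N1 + N2 + j) := by
    intro z' hz j
    rw [add_assoc, add_assoc, h1 z' (hz.mono (by omega))]
  have k2 : ∀ z', agX (N1 + N2) z z' → ∀ j, (h z').2 (M2 + N1 + j) = b • z'.2 (N1 + N2 + j) := by
    intro z' hz j
    rw [add_assoc, h2 z' (hz.mono (by omega)), add_comm N1 N2, add_assoc]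
  rcases le_total (M1 + N2) (M2 + N1) with hle | hle
  · obtain ⟨d, hd⟩ := Nat.exists_eq_add_of_le hle
    rw [hd] at k2
    exact label_unique_aux k1 k2
  · obtain ⟨d, hd⟩ := Nat.exists_eq_add_of_le hle
    rw [hd] at k1
    exact (label_unique_aux k2 k1).symm

/-- The bound function used for distortion. -/
def Bd (X : Finset G) (h : Equiv.Perm (XX G)) (m : ℕ) : Prop :=
  Cont h ∧ ∀ z, ∃ g, Label h z g ∧ wordLength X g ≤ m

lemma bd_mul (X : Finset G) (hX : Generates X) (h k : Equiv.Perm (XX G)) (m n : ℕ)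
    (h1 : Bd X h m) (h2 : Bd X k n) : Bd X (h * k) (m + n) := by
  refine ⟨cont_mul h1.1 h2.1, fun z => ?_⟩
  obtain ⟨b, hb, hb'⟩ := h2.2 z
  obtain ⟨a, ha, ha'⟩ := h1.2 (k z)
  exact ⟨a * b, label_mul h2.1 ha hb, (wl_mul X hX a b).trans (add_le_add ha' hb')⟩

lemma bd_gens (X : Finset G) (h : Equiv.Perm (XX G)) (hh : h ∈ gens G) : ∃ m, Bd X h m := by
  rcases hh with ⟨p, q, α, -, rfl⟩ | ⟨g, rfl⟩
  · exact ⟨0, cont_ih p q α, fun z => ⟨1, label_ih p q α z, by rw [wl_one]⟩⟩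
  · refine ⟨wordLength X g, cont_g0 g, ?_⟩
    rintro ⟨l, x⟩
    by_cases hl : l = 0
    · subst hl
      exact ⟨g, label_g0_zero g x, le_rfl⟩
    · exact ⟨1, label_g0_ne g l x hl, by rw [wl_one]; exact Nat.zero_le _⟩

lemma bd_HH (X : Finset G) (hX : Generates X) (h : Equiv.Perm (XX G)) (hh : h ∈ HH G) :
    ∃ m, Bd X h m := by
  induction hh using Subgroup.closure_induction'' with
  | mem x hx => exact bd_gens X x hx
  | inv_mem x hx => exact bd_gens X _ (gens_inv x hx)
  | one => exact ⟨0, cont_one, fun z => ⟨1, label_one z, by rw [wl_one]⟩⟩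
  | mul x y _ _ hx hy =>
    obtain ⟨m, hm⟩ := hx
    obtain ⟨n, hn⟩ := hy
    exact ⟨m + n, bd_mul X hX x y m n hm hn⟩

/-- The embedding. -/
def phi (G : Type) [Group G] : G →* HH G := g0.codRestrict (HH G) g0_mem

/-- The base point. -/
def pt : XX G := (0, fun _ => mkE none 0)

lemma lower_phi : LowerBd (phi G) := by
  intro X Y hX hY
  obtain ⟨C, hC⟩ := lin_bound Y hY (fun h m => Bd X (h : Equiv.Perm (XX G)) m)
    ⟨cont_one, fun z => ⟨1, label_one z, by rw [wl_one]⟩⟩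
    (fun a b m n h1 h2 => bd_mul X hX a b m n h1 h2)
    (fun a m n hmn h => ⟨h.1, fun z => by
      obtain ⟨g, hg, hg'⟩ := h.2 z
      exact ⟨g, hg, hg'.trans hmn⟩⟩)
    (fun a => bd_HH X hX a a.2)
  refine ⟨C, fun g => ?_⟩
  obtain ⟨g', h1, h2⟩ := (hC (phi G g)).2 pt
  have : g' = g := label_unique h1 (label_g0_zero g _)
  rw [← this] 
  rw [this] at h2 ⊢
  exact h2

lemma phi_inj : Function.Injective (phi G) := by
  intro a b h
  have h1 : (g0 a : Equiv.Perm (XX G)) = g0 b := congrArg Subtype.val h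
  have h2 := label_g0_zero a (pt : XX G).2
  rw [h1] at h2
  exact label_unique h2 (label_g0_zero b _)

lemma frattini_phi (hG : Group.FG G) : IsFrattini (phi G) := by
  refine frattini_of _ phi_inj ?_
  intro a b k hk
  obtain ⟨X, hX⟩ := exists_gen hG
  obtain ⟨m, hm, hm'⟩ := bd_HH X hX k k.2
  obtain ⟨g, hg, -⟩ := hm' pt
  have hk' : (k : Equiv.Perm (XX G)) * g0 a = g0 b * k := by
    have := congrArg Subtype.val (mul_inv_eq_iff_eq_mul.1 hk)
    exact this
  have hpt : (g0 a) (pt : XX G) = pt := rfl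
  have l1 : Label ((k : Equiv.Perm (XX G)) * g0 a) pt (g * a) :=
    label_mul (cont_g0 a) (by rw [hpt]; exact hg) (label_g0_zero a _)
  rw [hk'] at l1
  rcases hkp : (k : Equiv.Perm (XX G)) pt with ⟨l, x⟩
  by_cases hl : l = 0
  · have l2 : Label (g0 b * (k : Equiv.Perm (XX G))) pt (b * g) :=
      label_mul hm (by rw [hkp, hl]; exact label_g0_zero b _) hg
    have := label_unique l1 l2
    rw [isConj_iff]
    exact ⟨g, by rw [this]; group⟩
  · have l2 : Label (g0 b * (k : Equiv.Perm (XX G))) pt (1 * g) :=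
      label_mul hm (by rw [hkp]; exact label_g0_ne b _ _ hl) hg
    have := label_unique l1 l2
    have ha : a = 1 := by simpa using this
    subst ha
    have hb : phi G b = phi G 1 := by rw [← hk]; simp
    rw [phi_inj hb]

/-! Simplicity. -/

lemma alt_perfect : commutator (alternatingGroup (Fin 5)) = ⊤ :=
  commutator_alternatingGroup_eq_top (by rw [Nat.card_eq_fintype_card, Fintype.card_fin])

/-- A three-cycle. -/
def c3 : Equiv.Perm (Fin 5) := Equiv.swap 0 1 * Equiv.swap 1 2

lemma c3_mem : c3 ∈ alternatingGroup (Fin 5) := by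
  rw [Equiv.Perm.mem_alternatingGroup]; decide

lemma c3_zero : c3 0 = 1 := by decide

lemma exists_emb (l l' : Fin 9) (h : l ≠ l') : ∃ p : Fin 5 ↪ Fin 9, p 0 = l ∧ p 1 = l' := by
  let s1 : Equiv.Perm (Fin 9) := Equiv.swap 0 l
  let s : Equiv.Perm (Fin 9) := Equiv.swap (s1 1) l' * s1
  have h0 : s1 0 = l := Equiv.swap_apply_left _ _
  have h1 : l ≠ s1 1 := by
    rw [← h0]
    exact fun hh => absurd (s1.injective hh) (by decide)
  refine ⟨(Fin.castLEEmb (by norm_num : 5 ≤ 9)).trans s.toEmbedding, ?_, ?_⟩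
  · change Equiv.swap (s1 1) l' (s1 0) = l
    rw [h0, Equiv.swap_apply_of_ne_of_ne h1 h]
  · exact Equiv.swap_apply_left _ _

section Moves

lemma move (T : Subgroup (Equiv.Perm (XX G)))
    (hT : ∀ p q, ∀ α ∈ alternatingGroup (Fin 5), (ih p q α : Equiv.Perm (XX G)) ∈ T)
    (l l' : Fin 9) (h : l ≠ l') (q : Q) : ∃ k ∈ T, ∀ y : S G, k (l, y) = (l', qm q y) := by
  obtain ⟨p, rfl, rfl⟩ := exists_emb l l' h
  refine ⟨ih p q c3, hT p q c3 c3_mem, fun y => ?_⟩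
  have := ih_apply p q c3 0 y
  rw [c3_zero] at this
  exact this

lemma move' (T : Subgroup (Equiv.Perm (XX G)))
    (hT : ∀ p q, ∀ α ∈ alternatingGroup (Fin 5), (ih p q α : Equiv.Perm (XX G)) ∈ T)
    (l l' : Fin 9) : ∃ k ∈ T, ∀ y : S G, k (l, y) = (l', y) := by
  by_cases h : l = l'
  · subst h
    exact ⟨1, one_mem _, fun y => rfl⟩
  · exact move T hT l l' h none

lemma apply_q (T : Subgroup (Equiv.Perm (XX G)))
    (hT : ∀ p q, ∀ α ∈ alternatingGroup (Fin 5), (ih p q α : Equiv.Perm (XX G)) ∈ T)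
    (q : Q) : ∃ k ∈ T, ∀ y : S G, k (0, y) = (0, qm q y) := by
  obtain ⟨a, ha, ha'⟩ := move T hT 0 1 (by decide) q
  obtain ⟨b, hb, hb'⟩ := move' T hT 1 0
  refine ⟨b * a, mul_mem hb ha, fun y => ?_⟩
  rw [Equiv.Perm.mul_apply, ha', hb']

end Moves

lemma reach1 (f : Bool) (n : ℕ) : ∃ k ∈ HH G, ∀ y : S G,
    k (0, y) = (0, cons (mkE (if f then some 1 else none) n) y) := by
  induction n using Nat.strong_induction_on with
  | _ n IH =>
    by_cases hn : n = 0
    · subst hn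
      exact apply_q (HH G) ih_mem (some (Sum.inr (f, 0)))
    · obtain ⟨k, hk, hk'⟩ := IH (n / 2) (by omega)
      obtain ⟨v, hv, hv'⟩ := apply_q (HH G) ih_mem (some (Sum.inl (decide (n % 2 = 1))))
      refine ⟨v * k, mul_mem hv hk, fun y => ?_⟩
      rw [Equiv.Perm.mul_apply, hk', hv']
      refine Prod.ext rfl ?_
      funext i
      cases i with
      | succ m => rfl
      | zero =>
        refine Prod.ext rfl ?_
        change 2 * (n / 2) + (if (decide (n % 2 = 1)) = true then 1 else 0) = n
        by_cases h : n % 2 = 1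
        · rw [if_pos (by simpa using h)]; omega
        · rw [if_neg (by simpa using h)]; omega

lemma reach2 (e : E G) : ∃ g : G, ∃ k ∈ HH G, ∀ y : S G, k (0, y) = (0, cons e (g • y)) := by
  rcases e with ⟨_ | a, n⟩
  · obtain ⟨k, hk, hk'⟩ := reach1 (G := G) false n
    refine ⟨1, k, hk, fun y => ?_⟩
    rw [hk', one_smul]
    rfl
  · obtain ⟨k, hk, hk'⟩ := reach1 (G := G) true n
    refine ⟨a, g0 a * k, mul_mem (g0_mem a) hk, fun y => ?_⟩
    rw [Equiv.Perm.mul_apply, hk', g0_zero]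
    refine Prod.ext rfl ?_
    funext i
    cases i with
    | succ m => rfl
    | zero =>
      change a • mkE (some 1) n = mkE (some a) n
      rw [smul_some, mul_one]

lemma reach3 (n : ℕ) : ∀ x : S G, ∃ k ∈ HH G, ∀ y : S G, agX n (0, x) (k (0, y)) := by
  induction n with
  | zero => exact fun x => ⟨1, one_mem _, fun y => ⟨rfl, fun i hi => absurd hi (by omega)⟩⟩
  | succ n IH =>
    intro x
    obtain ⟨g, t, ht, ht'⟩ := reach2 (x 0)
    obtain ⟨k, hk, hk'⟩ := IH (g⁻¹ • fun i => x (i + 1))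
    refine ⟨t * k, mul_mem ht hk, fun y => ?_⟩
    obtain ⟨h1, h2⟩ := hk' y
    rw [Equiv.Perm.mul_apply]
    rcases hky : k (0, y) with ⟨l, w⟩
    rw [hky] at h1 h2
    simp only at h1 h2
    subst h1
    rw [ht']
    refine ⟨rfl, fun i hi => ?_⟩
    cases i with
    | zero => rfl
    | succ m =>
      have := h2 m (by omega)
      change x (m + 1) = g • w m
      rw [← this, Pi.smul_apply, smul_inv_smul]

lemma reach (n : ℕ) (z : XX G) (l : Fin 9) :
    ∃ k ∈ HH G, ∀ y : S G, agX n z (k (l, y)) := by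
  obtain ⟨a, ha, ha'⟩ := move' (HH G) ih_mem l 0
  obtain ⟨b, hb, hb'⟩ := move' (HH G) ih_mem 0 z.1
  obtain ⟨k, hk, hk'⟩ := reach3 n z.2
  refine ⟨b * k * a, mul_mem (mul_mem hb hk) ha, fun y => ?_⟩
  rw [Equiv.Perm.mul_apply, Equiv.Perm.mul_apply, ha']
  obtain ⟨h1, h2⟩ := hk' y
  rcases hky : k (0, y) with ⟨l', w⟩
  rw [hky] at h1 h2
  simp only at h1 h2
  subst h1
  rw [hb']
  exact ⟨rfl, h2⟩

lemma exists_compl (p : Fin 5 ↪ Fin 9) : ∃ l : Fin 4 → Fin 9, Function.Injective l ∧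
    ∀ i j, l i ≠ p j := by
  have hc : ((Finset.univ.map p)ᶜ).card = 4 := by
    rw [Finset.card_compl, Finset.card_map]; simp
  refine ⟨Finset.orderEmbOfFin _ hc, (Finset.orderEmbOfFin _ hc).injective, fun i j h => ?_⟩
  have := Finset.orderEmbOfFin_mem _ hc i
  rw [h] at this
  simp at this

lemma kappa (p : Fin 5 ↪ Fin 9) (l : Fin 4 → Fin 9) (hl : Function.Injective l)
    (hlp : ∀ i j, l i ≠ p j) (j : Fin 5) : ∃ k ∈ HH G,
    (∀ y : S G, k (p j, y) = (l 0, cons (mkE none j) y)) ∧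
    (∀ i, i ≠ j → ∀ y : S G, k (p i, y) = (p i, y)) ∧
    (∀ i : Fin 5, i ≠ j → ∀ y : S G,
      k (l 0, cons (mkE none i) y) = (l 0, cons (mkE none i) y)) := by
  let p' : Fin 5 ↪ Fin 9 := ⟨Fin.cons (p j) l, Fin.cons_injective_iff.2
    ⟨by rintro ⟨i, hi⟩; exact hlp i j hi, hl⟩⟩
  have hp0 : p' 0 = p j := rfl
  have hps : ∀ i : Fin 4, p' i.succ = l i := fun i => rfl
  have hp1 : p' 1 = l 0 := rfl
  refine ⟨ih p' (some (Sum.inr (false, j))) c3, ih_mem _ _ _ c3_mem, ?_, ?_, ?_⟩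
  · intro y
    have := ih_apply p' (some (Sum.inr (false, j))) c3 0 y
    rw [c3_zero] at this
    exact this
  · intro i hij y
    apply ih_out
    intro m x h
    have h1 := congrArg Prod.fst h
    simp only at h1
    refine Fin.cases ?_ (fun m' => ?_) m h1
    · intro h1
      exact hij (p.injective h1)
    · intro h1
      exact hlp _ _ h1.symm
  · intro i hij y
    apply ih_out
    intro m x h
    have h1 := congrArg Prod.fst h
    have h2 := congrArg Prod.snd h
    simp only at h1 h2
    rw [← hp1] at h1
    have h3 := p'.injective h1
    subst h3
    have h4 := congrArg Prod.snd (congrFun h2 0)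
    change (i : ℕ) = (j : ℕ) at h4
    exact hij (Fin.ext h4)

lemma collect (p : Fin 5 ↪ Fin 9) : ∃ l0 : Fin 9, ∃ k ∈ HH G, ∀ j, ∀ y : S G,
    ∃ y', k (p j, y) = (l0, y') := by
  obtain ⟨l, hl, hlp⟩ := exists_compl p
  have key : ∀ s : Finset (Fin 5), ∃ k ∈ HH G, ∀ j, ∀ y : S G,
      k (p j, y) = if j ∈ s then (l 0, cons (mkE none j) y) else (p j, y) := by
    intro s
    induction s using Finset.induction_on with
    | empty => exact ⟨1, one_mem _, fun j y => by simp⟩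
    | insert a s has IH =>
      obtain ⟨k, hk, hk'⟩ := IH
      obtain ⟨m, hm, m1, m2, m3⟩ := kappa (G := G) p l hl hlp a
      refine ⟨m * k, mul_mem hm hk, fun j y => ?_⟩
      rw [Equiv.Perm.mul_apply, hk']
      by_cases hj : j = a
      · subst hj
        rw [if_neg has, if_pos (Finset.mem_insert_self _ _), m1]
      · by_cases hjs : j ∈ s
        · rw [if_pos hjs, if_pos (Finset.mem_insert_of_mem hjs), m3 j hj]
        · rw [if_neg hjs, if_neg (by simp [hj, hjs]), m2 j hj]
  obtain ⟨k, hk, hk'⟩ := key Finset.univ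
  exact ⟨l 0, k, hk, fun j y => ⟨_, by rw [hk', if_pos (Finset.mem_univ _)]⟩⟩

lemma compress (p : Fin 5 ↪ Fin 9) (n : ℕ) (z : XX G) :
    ∃ k ∈ HH G, ∀ j, ∀ y : S G, agX n z (k (p j, y)) := by
  obtain ⟨l0, k, hk, hk'⟩ := collect (G := G) p
  obtain ⟨m, hm, hm'⟩ := reach n z l0
  refine ⟨m * k, mul_mem hm hk, fun j y => ?_⟩
  obtain ⟨y', hy⟩ := hk' j y
  rw [Equiv.Perm.mul_apply, hy]
  exact hm' y'

lemma separate (h : Equiv.Perm (XX G)) (hc : Cont h) (hne : h ≠ 1) :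
    ∃ (z0 : XX G) (n : ℕ), ∀ z z', agX n z0 z → agX n z0 z' → h z ≠ z' := by
  have : ∃ x, h x ≠ x := by
    by_contra hcon
    push Not at hcon
    exact hne (Equiv.ext hcon)
  obtain ⟨x, hx⟩ := this
  have : ∃ n, ¬ agX n x (h x) := by
    by_contra hcon
    push Not at hcon
    apply hx
    refine (Prod.ext (hcon 0).1 ?_).symm
    funext i
    exact (hcon (i + 1)).2 i (by omega)
  obtain ⟨n, hn⟩ := this
  obtain ⟨m, hm⟩ := hc x n
  refine ⟨x, m + n, ?_⟩
  rintro z z' hz hz' rfl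
  apply hn
  have h1 := hm z (hz.mono (by omega))
  have h2 := hz'.mono (show n ≤ m + n by omega)
  exact ⟨h2.1.trans h1.1.symm, fun i hi => (h2.2 i hi).trans (h1.2 i hi).symm⟩

section Normal

lemma comm_mem (N : Subgroup (Equiv.Perm (XX G)))
    (hN : ∀ n ∈ N, ∀ k ∈ HH G, k * n * k⁻¹ ∈ N)
    (h : Equiv.Perm (XX G)) (hh : h ∈ N) (B : Set (XX G))
    (hB : ∀ z ∈ B, h z ∉ B) (A b : Equiv.Perm (XX G)) (hA : A ∈ HH G) (hb : b ∈ HH G)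
    (sA : ∀ z, z ∉ B → A z = z) (sb : ∀ z, z ∉ B → b z = z) :
    A * b * A⁻¹ * b⁻¹ ∈ N := by
  let c := h * A⁻¹ * h⁻¹
  have sc : ∀ z, z ∈ B → c z = z := by
    intro z hz
    have h1 : h⁻¹ z ∉ B := fun h1 => hB _ h1 (by simpa using hz)
    have h2 : A⁻¹ (h⁻¹ z) = h⁻¹ z := by
      rw [Equiv.Perm.inv_eq_iff_eq, sA _ h1]
    change h (A⁻¹ (h⁻¹ z)) = z
    rw [h2]; simp
  have hd : Equiv.Perm.Disjoint c b := by
    intro z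
    by_cases hz : z ∈ B
    · exact Or.inl (sc z hz)
    · exact Or.inr (sb z hz)
  have hcb : c * b = b * c := hd.commute.eq
  have hAc : A * c ∈ N := by
    have : A * c = (A * h * A⁻¹) * h⁻¹ := by simp only [c]; group
    rw [this]
    exact mul_mem (hN h hh A hA) (inv_mem hh)
  have e : A * b * A⁻¹ * b⁻¹ = (A * c) * (b * (A * c)⁻¹ * b⁻¹) := by
    calc A * b * A⁻¹ * b⁻¹ = A * (b * c) * c⁻¹ * A⁻¹ * b⁻¹ := by group
      _ = A * (c * b) * c⁻¹ * A⁻¹ * b⁻¹ := by rw [hcb]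
      _ = _ := by group
  rw [e]
  exact mul_mem hAc (hN _ (inv_mem hAc) b hb)

lemma ih_comm_mem (N : Subgroup (Equiv.Perm (XX G)))
    (hN : ∀ n ∈ N, ∀ k ∈ HH G, k * n * k⁻¹ ∈ N)
    (h : Equiv.Perm (XX G)) (hh : h ∈ N) (hc : Cont h) (hne : h ≠ 1)
    (p : Fin 5 ↪ Fin 9) (q : Q) (α β : Equiv.Perm (Fin 5))
    (hα : α ∈ alternatingGroup (Fin 5)) (hβ : β ∈ alternatingGroup (Fin 5)) :
    (ih p q (α * β * α⁻¹ * β⁻¹) : Equiv.Perm (XX G)) ∈ N := by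
  obtain ⟨z0, n, hz0⟩ := separate h hc hne
  obtain ⟨k, hk, hk'⟩ := compress p n z0
  have sup : ∀ γ : Equiv.Perm (Fin 5), ∀ z, z ∉ {z | agX n z0 z} →
      (k * ih p q γ * k⁻¹ : Equiv.Perm (XX G)) z = z := by
    intro γ z hz
    have : ih p q γ (k⁻¹ z) = k⁻¹ z := by
      apply ih_out
      intro j x hx
      apply hz
      have := hk' j (qm (qj q j) x)
      rw [← hx] at this
      simpa using this
    rw [Equiv.Perm.mul_apply, Equiv.Perm.mul_apply, this]
    simp
  have hmem : ∀ γ ∈ alternatingGroup (Fin 5), k * ih p q γ * k⁻¹ ∈ HH G := fun γ hγ =>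
    mul_mem (mul_mem hk (ih_mem p q γ hγ)) (inv_mem hk)
  have := comm_mem N hN h hh {z | agX n z0 z} (fun z hz hz' => hz0 z _ hz hz' rfl) _ _
    (hmem α hα) (hmem β hβ) (sup α) (sup β)
  have := hN _ this k⁻¹ (inv_mem hk)
  convert this using 1
  simp only [map_mul, map_inv]
  group

lemma ih_mem_N (N : Subgroup (Equiv.Perm (XX G)))
    (hN : ∀ n ∈ N, ∀ k ∈ HH G, k * n * k⁻¹ ∈ N)
    (h : Equiv.Perm (XX G)) (hh : h ∈ N) (hc : Cont h) (hne : h ≠ 1)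
    (p : Fin 5 ↪ Fin 9) (q : Q) (α : Equiv.Perm (Fin 5))
    (hα : α ∈ alternatingGroup (Fin 5)) : (ih p q α : Equiv.Perm (XX G)) ∈ N := by
  let f : alternatingGroup (Fin 5) →* Equiv.Perm (XX G) :=
    (ih p q).comp (alternatingGroup (Fin 5)).subtype
  have h0 : ∀ a b : alternatingGroup (Fin 5), f (a * b * a⁻¹ * b⁻¹) ∈ N := fun a b =>
    ih_comm_mem N hN h hh hc hne p q a b a.2 b.2
  have h1 : commutator (alternatingGroup (Fin 5)) ≤ N.comap f := by
    rw [commutator_def, Subgroup.commutator_le]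
    intro a _ b _
    exact h0 a b
  have h2 := alt_perfect
  rw [h2] at h1
  have h3 : f ⟨α, hα⟩ ∈ N := h1 (Subgroup.mem_top _)
  exact h3

lemma g0_mem_N (N : Subgroup (Equiv.Perm (XX G)))
    (hN : ∀ n ∈ N, ∀ k ∈ HH G, k * n * k⁻¹ ∈ N)
    (hT : ∀ p q, ∀ α ∈ alternatingGroup (Fin 5), (ih p q α : Equiv.Perm (XX G)) ∈ N)
    (g : G) : (g0 g : Equiv.Perm (XX G)) ∈ N := by
  have hv : ∀ e : Bool, ∃ v ∈ N, ∀ y : S G, v (0, y) = (0, uS e y) := fun e =>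
    apply_q N hT (some (Sum.inl e))
  choose v hvN hv using hv
  let c : Bool → Equiv.Perm (XX G) := fun e => v e * g0 g * (v e)⁻¹
  have hcin : ∀ e (x : S G), c e (0, uS e x) = (0, g • uS e x) := by
    intro e x
    have h1 : (v e)⁻¹ (0, uS e x) = (0, x) := by
      rw [Equiv.Perm.inv_eq_iff_eq, hv]
    change v e (g0 g ((v e)⁻¹ (0, uS e x))) = _
    rw [h1, g0_zero, hv]
    refine Prod.ext rfl ?_
    funext i
    cases i <;> rfl
  have hcout : ∀ e (z : XX G), (∀ x, z ≠ (0, uS e x)) → c e z = z := by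
    intro e z hz
    change v e (g0 g ((v e)⁻¹ z)) = z
    rcases hw : (v e)⁻¹ z with ⟨l, x⟩
    have hw' : z = v e (l, x) := by rw [← hw]; simp
    by_cases hl : l = 0
    · subst hl
      rw [hv] at hw'
      exact absurd hw' (hz x)
    · rw [g0_ne g l x hl, ← hw']
  have hdisj : ∀ (x y : S G), uS false x ≠ uS true y := by
    intro x y h
    have := congrArg Prod.snd (congrFun h 0)
    simp only [uS_zero, mkE] at this
    simp at this
    omega
  have hsm : ∀ e (x : S G), g • uS e x = uS e (g • x) := by
    intro e x
    funext i
    cases i <;> rfl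
  have key : g0 g = c false * c true := by
    apply Equiv.ext
    rintro ⟨l, x⟩
    rw [Equiv.Perm.mul_apply]
    by_cases hl : l = 0
    · subst hl
      rw [g0_zero]
      have hx : ∃ e y, x = uS e y := by
        refine ⟨decide ((x 0).2 % 2 = 1), cons (mkE (x 0).1 ((x 0).2 / 2)) (fun i => x (i + 1)), ?_⟩
        funext i
        cases i with
        | succ m => rfl
        | zero =>
          refine Prod.ext rfl ?_
          change (x 0).2 = 2 * ((x 0).2 / 2) +
            (if (decide ((x 0).2 % 2 = 1)) = true then 1 else 0)
          by_cases h : (x 0).2 % 2 = 1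
          · rw [if_pos (by simpa using h)]; omega
          · rw [if_neg (by simpa using h)]; omega
      obtain ⟨e, y, rfl⟩ := hx
      cases e with
      | false =>
        rw [hcout true, hcin]
        intro w hw
        exact hdisj _ _ (congrArg Prod.snd hw)
      | true =>
        rw [hcin, hcout false]
        intro w hw
        rw [hsm] at hw
        exact hdisj _ _ (congrArg Prod.snd hw).symm
    · rw [g0_ne g l x hl, hcout true, hcout false]
      · exact fun w hw => hl (congrArg Prod.fst hw)
      · exact fun w hw => hl (congrArg Prod.fst hw)
  have hn : ∀ e, v e * (g0 g * (v e)⁻¹ * (g0 g)⁻¹) ∈ N := fun e =>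
    mul_mem (hvN e) (hN _ (inv_mem (hvN e)) _ (g0_mem g))
  have fin : g0 g = (v false * (g0 g * (v false)⁻¹ * (g0 g)⁻¹))⁻¹ *
      (v true * (g0 g * (v true)⁻¹ * (g0 g)⁻¹))⁻¹ := by
    have k2 : g0 g = (v false * (g0 g * (v false)⁻¹ * (g0 g)⁻¹)) * g0 g *
        ((v true * (g0 g * (v true)⁻¹ * (g0 g)⁻¹)) * g0 g) := by
      conv_lhs => rw [key]
      simp only [c]; group
    generalize v false * (g0 g * (v false)⁻¹ * (g0 g)⁻¹) = a at k2 ⊢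
    generalize v true * (g0 g * (v true)⁻¹ * (g0 g)⁻¹) = b at k2 ⊢
    generalize (g0 g : Equiv.Perm (XX G)) = x at k2 ⊢
    have k3 : a * x * b = 1 := by
      have : 1 * x = (a * x * b) * x := by
        rw [one_mul]; conv_lhs => rw [k2]
        group
      exact (mul_right_cancel this).symm
    calc x = a⁻¹ * (a * x * b) * b⁻¹ := by group
      _ = _ := by rw [k3]; group
  rw [fin]
  exact mul_mem (inv_mem (hn _)) (inv_mem (hn _))

end Normal

lemma HH_simple (hG : Group.FG G) : IsSimpleGroup (HH G) := by
  obtain ⟨X, hX⟩ := exists_gen hG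
  have hnt : Nontrivial (HH G) := by
    obtain ⟨k, hk, hk'⟩ := move (HH G) ih_mem 0 1 (by decide) none
    refine ⟨⟨k, hk⟩, 1, fun h => ?_⟩
    have h1 : k = 1 := congrArg Subtype.val h
    have h2 := congrArg Prod.fst (hk' (pt : XX G).2)
    rw [h1] at h2
    change (0 : Fin 9) = 1 at h2
    exact absurd h2 (by decide)
  refine { eq_bot_or_eq_top_of_normal := fun N hNn => ?_ }
  by_cases hb : N = ⊥
  · exact Or.inl hb
  right
  obtain ⟨⟨⟨h, hH⟩, hhN⟩, hne0⟩ := Subgroup.ne_bot_iff_exists_ne_one.1 hb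
  have hne : (⟨h, hH⟩ : HH G) ≠ 1 := fun h1 => hne0 (Subtype.ext h1)
  let N' : Subgroup (Equiv.Perm (XX G)) := N.map (HH G).subtype
  have hN : ∀ n ∈ N', ∀ k ∈ HH G, k * n * k⁻¹ ∈ N' := by
    rintro _ ⟨a, ha, rfl⟩ k hk
    exact ⟨⟨k, hk⟩ * a * ⟨k, hk⟩⁻¹, hNn.conj_mem a ha _, rfl⟩
  have hhN' : h ∈ N' := ⟨⟨h, hH⟩, hhN, rfl⟩
  have hne' : h ≠ 1 := fun h1 => hne (Subtype.ext h1)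
  obtain ⟨m, hc, -⟩ := bd_HH X hX h hH
  have hT := ih_mem_N N' hN h hhN' hc hne'
  have hle : HH G ≤ N' := by
    rw [HH, Subgroup.closure_le]
    rintro _ (⟨p, q, α, hα, rfl⟩ | ⟨g, rfl⟩)
    · exact hT p q α hα
    · exact g0_mem_N N' hN hT g
  rw [eq_top_iff]
  rintro ⟨a, ha⟩ -
  obtain ⟨b, hb, hba⟩ := hle ha
  have : b = ⟨a, ha⟩ := Subtype.ext hba
  rw [← this]
  exact hb

end Simple

end QF

theorem family_qi_frattini_embedding_into_fg_simple
    (G : ℕ → Type) [∀ i, Group (G i)] (hfg : ∀ i, Group.FG (G i)) :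
    ∃ (H : Type) (_ : Group H), Group.FG H ∧ IsSimpleGroup H ∧
      ∀ i, ∃ (X : Finset (G i)) (Y : Finset H) (φ : G i →* H),
        Generates X ∧ Generates Y ∧ IsQIEmbedding X Y φ ∧ IsFrattini φ := by
  obtain ⟨K, instK, hK, hφ⟩ := QF.family_step G hfg
  refine ⟨QF.HH K, inferInstance, QF.HH_fg hK, QF.HH_simple hK, fun i => ?_⟩
  obtain ⟨φ, h1, h2⟩ := hφ i
  obtain ⟨X, hX⟩ := QF.exists_gen (hfg i)
  obtain ⟨Y, hY⟩ := QF.exists_gen (QF.HH_fg hK)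
  have h3 := QF.frattini_comp h2 (QF.frattini_phi hK)
  exact ⟨X, Y, (QF.phi K).comp φ, hX, hY,
    QF.qi_of_lower _ h3.1 (QF.LowerBd.comp hK h1 QF.lower_phi) X Y hX hY, h3⟩
end

section
/- For every countable family (G_i)_{i∈ℕ} of finitely generated groups there exists a group H̃ generated by two elements such that every G_i admits an embedding into H̃ that is simultaneously quasi-isometric and Frattini (with respect to suitable finite generating sets). -/
/-- Shift of the first coordinate. -/
def shiftPerm (A : Type) : Equiv.Perm (ℤ × ℤ × A) where
  toFun z := (z.1 + 1, z.2.1, z.2.2)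
  invFun z := (z.1 - 1, z.2.1, z.2.2)
  left_inv z := by ext <;> simp
  right_inv z := by ext <;> simp

/-- The second generator: shift of the second coordinate over `0`, and multiplication by `y p`
on the nonnegative half of the line over `p ≠ 0`. -/
def genPerm {A : Type} [Group A] (y : ℤ → A) : Equiv.Perm (ℤ × ℤ × A) where
  toFun z := if z.1 = 0 then (z.1, z.2.1 + 1, z.2.2)
    else if 0 ≤ z.2.1 then (z.1, z.2.1, y z.1 * z.2.2) else z
  invFun z := if z.1 = 0 then (z.1, z.2.1 - 1, z.2.2)
    else if 0 ≤ z.2.1 then (z.1, z.2.1, (y z.1)⁻¹ * z.2.2) else z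
  left_inv := by
    rintro ⟨p, q, g⟩
    by_cases hp : p = 0 <;> by_cases hq : 0 ≤ q <;> simp [hp, hq]
  right_inv := by
    rintro ⟨p, q, g⟩
    by_cases hp : p = 0 <;> by_cases hq : 0 ≤ q <;> simp [hp, hq]

/-- Multiplication by `a` on the fiber over `(0,0)`. -/
def deltaPerm (A : Type) [Group A] : A →* Equiv.Perm (ℤ × ℤ × A) where
  toFun a :=
    { toFun := fun z => if z.1 = 0 ∧ z.2.1 = 0 then (z.1, z.2.1, a * z.2.2) else z
      invFun := fun z => if z.1 = 0 ∧ z.2.1 = 0 then (z.1, z.2.1, a⁻¹ * z.2.2) else z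
      left_inv := by
        rintro ⟨p, q, g⟩
        by_cases h : p = 0 ∧ q = 0 <;> simp [h]
      right_inv := by
        rintro ⟨p, q, g⟩
        by_cases h : p = 0 ∧ q = 0 <;> simp [h] }
  map_one' := by
    ext1 ⟨p, q, g⟩
    by_cases h : p = 0 ∧ q = 0 <;> simp [h]
  map_mul' a b := by
    ext1 ⟨p, q, g⟩
    by_cases h : p = 0 ∧ q = 0 <;> simp [h, mul_assoc]

theorem shiftPerm_apply {A : Type} (p q : ℤ) (g : A) :
    shiftPerm A (p, q, g) = (p + 1, q, g) := rfl

theorem shiftPerm_symm_apply {A : Type} (p q : ℤ) (g : A) :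
    (shiftPerm A)⁻¹ (p, q, g) = (p - 1, q, g) := rfl

theorem genPerm_apply {A : Type} [Group A] (y : ℤ → A) (p q : ℤ) (g : A) :
    genPerm y (p, q, g) = if p = 0 then (p, q + 1, g)
      else if 0 ≤ q then (p, q, y p * g) else (p, q, g) := rfl

theorem genPerm_symm_apply {A : Type} [Group A] (y : ℤ → A) (p q : ℤ) (g : A) :
    (genPerm y)⁻¹ (p, q, g) = if p = 0 then (p, q - 1, g)
      else if 0 ≤ q then (p, q, (y p)⁻¹ * g) else (p, q, g) := rfl

theorem deltaPerm_apply {A : Type} [Group A] (a : A) (p q : ℤ) (g : A) :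
    deltaPerm A a (p, q, g) = if p = 0 ∧ q = 0 then (p, q, a * g) else (p, q, g) := rfl

theorem shiftPerm_pow_apply {A : Type} (n : ℕ) (p q : ℤ) (g : A) :
    (shiftPerm A ^ n) (p, q, g) = (p + n, q, g) := by
  induction n generalizing p with
  | zero => simp
  | succ n ih =>
    rw [pow_succ, Equiv.Perm.mul_apply, shiftPerm_apply, ih]
    push_cast
    congr 1
    ring

theorem shiftPerm_pow_inv_apply {A : Type} (n : ℕ) (p q : ℤ) (g : A) :
    (shiftPerm A ^ n)⁻¹ (p, q, g) = (p - n, q, g) := by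
  rw [Equiv.Perm.inv_eq_iff_eq, shiftPerm_pow_apply]
  simp

/-- The conjugate of the second generator by a power of the shift. -/
theorem conj_apply {A : Type} [Group A] (y : ℤ → A) (n : ℕ) (p q : ℤ) (g : A) :
    ((shiftPerm A ^ n)⁻¹ * genPerm y * shiftPerm A ^ n) (p, q, g) =
      if p + n = 0 then (p, q + 1, g)
      else if 0 ≤ q then (p, q, y (p + n) * g) else (p, q, g) := by
  rw [Equiv.Perm.mul_apply, Equiv.Perm.mul_apply, shiftPerm_pow_apply, genPerm_apply]
  split_ifs <;> rw [shiftPerm_pow_inv_apply] <;> simp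

/-- The commutator identity. -/
theorem commutator_identity {A : Type} [Group A] (y : ℤ → A)
    (hy : ∀ p, y p ≠ 1 → 0 < p ∧ p % 2 = 1) (n : ℕ) (hn : n % 2 = 1) :
    deltaPerm A (y n) = ((shiftPerm A ^ n)⁻¹ * genPerm y * shiftPerm A ^ n) * genPerm y *
      ((shiftPerm A ^ n)⁻¹ * genPerm y * shiftPerm A ^ n)⁻¹ * (genPerm y)⁻¹ := by
  rw [eq_mul_inv_iff_mul_eq, eq_mul_inv_iff_mul_eq]
  ext1 ⟨p, q, g⟩
  rw [Equiv.Perm.mul_apply (deltaPerm A (y n) * genPerm y), Equiv.Perm.mul_apply (deltaPerm A (y n)),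
    Equiv.Perm.mul_apply _ (genPerm y), conj_apply]
  have hn0 : (n : ℤ) ≠ 0 := by omega
  by_cases hp : p = 0
  · subst hp
    have e1 : genPerm y (0, q, g) = (0, q + 1, g) := by simp [genPerm_apply]
    rw [e1, conj_apply]
    simp only [zero_add, hn0, if_false]
    by_cases hq : 0 ≤ q
    · have h1 : 0 ≤ q + 1 := by omega
      have h2 : q + 1 ≠ 0 := by omega
      simp [hq, h1, h2, genPerm_apply, deltaPerm_apply]
    · by_cases hq2 : q + 1 = 0
      · simp [hq, hq2, genPerm_apply, deltaPerm_apply]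
      · have h1 : ¬ 0 ≤ q + 1 := by omega
        simp [hq, hq2, h1, genPerm_apply, deltaPerm_apply]
  · by_cases hp2 : p + n = 0
    · have h1 : y p = 1 := by
        by_contra h
        have := hy p h
        omega
      by_cases hq : 0 ≤ q <;> by_cases hq1 : 0 ≤ q + 1 <;>
        simp [hp, hp2, h1, hq, hq1, genPerm_apply, deltaPerm_apply, conj_apply]
    · have h1 : y p * y (p + n) = y (p + n) * y p := by
        by_cases ha : y p = 1
        · simp [ha]
        by_cases hb : y (p + n) = 1
        · simp [hb]
        have := hy _ ha
        have := hy _ hb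
        omega
      by_cases hq : 0 ≤ q
      · simp [hp, hp2, hq, genPerm_apply, deltaPerm_apply, conj_apply, ← mul_assoc, h1]
      · simp [hp, hp2, hq, genPerm_apply, deltaPerm_apply, conj_apply]

/-- `c` is a product of at most `n` letters. -/
def InBall {A : Type} [Group A] (X : Finset A) (n : ℕ) (c : A) : Prop :=
  ∃ w : List A, w.length ≤ n ∧ (∀ a ∈ w, a ∈ X ∨ a⁻¹ ∈ X) ∧ w.prod = c

theorem InBall.wordLength_le {A : Type} [Group A] {X : Finset A} {n : ℕ} {c : A}
    (h : InBall X n c) : wordLength X c ≤ n := by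
  obtain ⟨w, h1, h2, h3⟩ := h
  have h4 : wordLength X c ≤ w.length := Nat.sInf_le ⟨w, rfl, h2, h3⟩
  exact h4.trans h1

theorem InBall.mul {A : Type} [Group A] {X : Finset A} {n m : ℕ} {c d : A}
    (h : InBall X n c) (h' : InBall X m d) : InBall X (n + m) (c * d) := by
  obtain ⟨w, h1, h2, h3⟩ := h
  obtain ⟨w', h1', h2', h3'⟩ := h'
  refine ⟨w ++ w', by simp; omega, ?_, by simp [h3, h3']⟩
  intro a ha
  rcases List.mem_append.1 ha with h | h
  · exact h2 a h
  · exact h2' a h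

theorem InBall.one {A : Type} [Group A] {X : Finset A} {n : ℕ} : InBall X n (1 : A) :=
  ⟨[], by simp, by simp, by simp⟩

theorem InBall.inv {A : Type} [Group A] {X : Finset A} {n : ℕ} {c : A}
    (h : InBall X n c) : InBall X n c⁻¹ := by
  obtain ⟨w, h1, h2, h3⟩ := h
  refine ⟨(w.map (·⁻¹)).reverse, by simpa using h1, ?_, by rw [← h3, List.prod_inv_reverse]⟩
  intro a ha
  simp only [List.mem_reverse, List.mem_map] at ha
  obtain ⟨b, hb, rfl⟩ := ha
  rcases h2 b hb with h | h
  · right; simpa using h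
  · left; exact h

theorem InBall.of_mem {A : Type} [Group A] {X : Finset A} {c : A}
    (h : c ∈ X) : InBall X 1 c :=
  ⟨[c], by simp, by simp [h], by simp⟩

theorem inBall_wordLength {A : Type} [Group A] {X : Finset A} (hX : Generates X) (c : A) :
    InBall X (wordLength X c) c := by
  have hne : {n | ∃ w : List A, w.length = n ∧ (∀ a ∈ w, a ∈ X ∨ a⁻¹ ∈ X) ∧
      w.prod = c}.Nonempty := by
    have hc : c ∈ Subgroup.closure (X : Set A) := by
      rw [show Subgroup.closure (X : Set A) = ⊤ from hX]; trivial
    rw [← Subgroup.mem_toSubmonoid, Subgroup.closure_toSubmonoid] at hc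
    obtain ⟨l, hl, hp⟩ := Submonoid.exists_list_of_mem_closure hc
    exact ⟨l.length, l, rfl, by simpa using hl, hp⟩
  obtain ⟨w, h1, h2, h3⟩ := Nat.sInf_mem hne
  exact ⟨w, h1.le, h2, h3⟩

/-- A homomorphism between finitely generated groups is Lipschitz. -/
theorem lipschitz_of_hom {A B : Type} [Group A] [Group B] {X : Finset A} {Y : Finset B}
    (hX : Generates X) (hY : Generates Y) (f : A →* B) :
    ∃ C : ℕ, ∀ a, wordLength Y (f a) ≤ C * wordLength X a := by
  refine ⟨∑ x ∈ X, wordLength Y (f x), fun a => ?_⟩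
  set C := ∑ x ∈ X, wordLength Y (f x) with hC
  obtain ⟨w, h1, h2, h3⟩ := inBall_wordLength hX a
  have hmono : ∀ n m c, n ≤ m → InBall Y n c → InBall Y m c := by
    rintro n m c hnm ⟨u, hu, hu'⟩
    exact ⟨u, hu.trans hnm, hu'⟩
  have hx : ∀ x ∈ X, InBall Y C (f x) := fun x hx =>
    hmono _ _ _ (Finset.single_le_sum (f := fun x => wordLength Y (f x))
      (fun _ _ => Nat.zero_le _) hx) (inBall_wordLength hY _)
  have key : ∀ w : List A, (∀ a ∈ w, a ∈ X ∨ a⁻¹ ∈ X) →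
      InBall Y (C * w.length) (f w.prod) := by
    intro w
    induction w with
    | nil => intro _; simpa using InBall.one
    | cons b w ih =>
      intro hw
      have hb : InBall Y C (f b) := by
        rcases hw b (by simp) with h | h
        · exact hx b h
        · simpa using (hx _ h).inv
      have := hb.mul (ih fun a ha => hw a (by simp [ha]))
      rw [List.prod_cons, map_mul, List.length_cons]
      convert this using 1
      ring
  have := (key w h2).wordLength_le
  rw [h3] at this
  exact this.trans (Nat.mul_le_mul_left _ h1)

/-- A monomial permutation with multipliers in the ball of radius `n`. -/
def Good {A : Type} [Group A] (X : Finset A) (n : ℕ) (σ : Equiv.Perm (ℤ × ℤ × A)) : Prop :=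
  ∀ p q, ∃ p' q' c, InBall X n c ∧ ∀ g, σ (p, q, g) = (p', q', c * g)

theorem Good.mul {A : Type} [Group A] {X : Finset A} {n m : ℕ}
    {σ τ : Equiv.Perm (ℤ × ℤ × A)} (h : Good X n σ) (h' : Good X m τ) :
    Good X (n + m) (σ * τ) := by
  intro p q
  obtain ⟨p', q', c, hc, e⟩ := h' p q
  obtain ⟨p'', q'', c', hc', e'⟩ := h p' q'
  refine ⟨p'', q'', c' * c, hc'.mul hc, fun g => ?_⟩
  rw [Equiv.Perm.mul_apply, e, e', mul_assoc]

theorem good_one {A : Type} [Group A] {X : Finset A} :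
    Good X 0 (1 : Equiv.Perm (ℤ × ℤ × A)) :=
  fun p q => ⟨p, q, 1, InBall.one, by simp⟩

theorem good_shift {A : Type} [Group A] {X : Finset A} : Good X 1 (shiftPerm A) :=
  fun p q => ⟨p + 1, q, 1, InBall.one, by simp [shiftPerm_apply]⟩

theorem good_shift_inv {A : Type} [Group A] {X : Finset A} : Good X 1 (shiftPerm A)⁻¹ :=
  fun p q => ⟨p - 1, q, 1, InBall.one, fun g => by rw [shiftPerm_symm_apply, one_mul]⟩

theorem good_gen {A : Type} [Group A] {X : Finset A} (y : ℤ → A) (hy : ∀ p, y p ∈ X) :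
    Good X 1 (genPerm y) := by
  intro p q
  by_cases hp : p = 0
  · exact ⟨p, q + 1, 1, InBall.one, by simp [genPerm_apply, hp]⟩
  by_cases hq : 0 ≤ q
  · exact ⟨p, q, y p, InBall.of_mem (hy p), by simp [genPerm_apply, hp, hq]⟩
  · exact ⟨p, q, 1, InBall.one, by simp [genPerm_apply, hp, hq]⟩

theorem good_gen_inv {A : Type} [Group A] {X : Finset A} (y : ℤ → A) (hy : ∀ p, y p ∈ X) :
    Good X 1 (genPerm y)⁻¹ := by
  intro p q
  by_cases hp : p = 0
  · exact ⟨p, q - 1, 1, InBall.one, fun g => by rw [genPerm_symm_apply]; simp [hp]⟩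
  by_cases hq : 0 ≤ q
  · exact ⟨p, q, (y p)⁻¹, (InBall.of_mem (hy p)).inv,
      fun g => by rw [genPerm_symm_apply]; simp [hp, hq]⟩
  · exact ⟨p, q, 1, InBall.one, fun g => by rw [genPerm_symm_apply]; simp [hp, hq]⟩

theorem deltaPerm_injective {A : Type} [Group A] : Function.Injective (deltaPerm A) := by
  intro a b h
  have := congrArg (fun σ => σ ((0 : ℤ), (0 : ℤ), (1 : A))) h
  simpa [deltaPerm_apply] using this

/-- Conjugacy is detected by monomial permutations. -/
theorem isConj_of_good {A : Type} [Group A] {X : Finset A} {n : ℕ} {a b : A}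
    {σ : Equiv.Perm (ℤ × ℤ × A)} (h : Good X n σ)
    (e : σ * deltaPerm A a = deltaPerm A b * σ) : IsConj a b := by
  obtain ⟨p, q, c, -, hc⟩ := h 0 0
  have h1 := congrArg (fun σ => σ ((0 : ℤ), (0 : ℤ), (1 : A))) e
  simp only [Equiv.Perm.mul_apply, hc, deltaPerm_apply] at h1
  by_cases hpq : p = 0 ∧ q = 0
  · simp [hpq, hc] at h1
    rw [isConj_iff]
    exact ⟨c, by rw [h1]; group⟩
  · simp [hpq, hc] at h1
    subst h1
    rw [map_one, mul_one] at e
    have hb : deltaPerm A b = 1 := mul_eq_right.1 e.symm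
    have : b = 1 := deltaPerm_injective (by rw [hb, map_one])
    rw [this]

theorem family_qi_frattini_embedding_into_two_generated
    (G : ℕ → Type) [∀ i, Group (G i)] (hfg : ∀ i, Group.FG (G i)) :
    ∃ (H : Type) (_ : Group H) (a b : H),
      Subgroup.closure {a, b} = ⊤ ∧
      ∀ i, ∃ (X : Finset (G i)) (Y : Finset H) (φ : G i →* H),
        Generates X ∧ Generates Y ∧ IsQIEmbedding X Y φ ∧ IsFrattini φ := by
  classical
  -- generating sets containing `1`, with enumerations
  have hX : ∀ i, ∃ X : Finset (G i), Generates X ∧ (1 : G i) ∈ X := by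
    intro i
    obtain ⟨S, hS⟩ := (Group.fg_def.1 (hfg i))
    refine ⟨insert 1 S, ?_, by simp⟩
    rw [Generates, eq_top_iff, ← hS]
    exact Subgroup.closure_mono (by simp)
  choose X hXgen hX1 using hX
  have he : ∀ i, ∃ e : ℕ → G i, Set.range e = (X i : Set (G i)) := by
    intro i
    obtain ⟨e, he⟩ := (X i).countable_toSet.exists_eq_range ⟨1, hX1 i⟩
    exact ⟨e, he.symm⟩
  choose e he using he
  let y : ∀ i, ℤ → G i := fun i p =>
    if 0 < p ∧ p % 2 = 1 ∧ (Nat.unpair (p / 2).toNat).1 = i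
      then e i (Nat.unpair (p / 2).toNat).2 else 1
  have hyodd : ∀ i p, y i p ≠ 1 → 0 < p ∧ p % 2 = 1 := by
    intro i p h
    by_contra hcon
    apply h
    simp only [y]
    rw [if_neg]
    tauto
  have hyX : ∀ i p, y i p ∈ X i := by
    intro i p
    simp only [y]
    split_ifs
    · have : e i (Nat.unpair (p / 2).toNat).2 ∈ (X i : Set (G i)) := by
        rw [← he]; exact ⟨_, rfl⟩
      exact this
    · exact hX1 i
  have hyval : ∀ i j k, y k ((2 * Nat.pair i j + 1 : ℕ) : ℤ) = if i = k then e k j else 1 := by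
    intro i j k
    have h2 : (((2 * Nat.pair i j + 1 : ℕ) : ℤ) / 2).toNat = Nat.pair i j := by omega
    have h3 : 0 < ((2 * Nat.pair i j + 1 : ℕ) : ℤ) := by omega
    have h4 : ((2 * Nat.pair i j + 1 : ℕ) : ℤ) % 2 = 1 := by omega
    simp only [y, h2, h3, h4, Nat.unpair_pair, true_and]
  let P := ∀ i, Equiv.Perm (ℤ × ℤ × G i)
  let s : P := fun i => shiftPerm (G i)
  let v : P := fun i => genPerm (y i)
  let K : Subgroup P := Subgroup.closure {s, v}
  have hs : s ∈ K := Subgroup.subset_closure (by simp)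
  have hv : v ∈ K := Subgroup.subset_closure (by simp)
  let a : K := ⟨s, hs⟩
  let b : K := ⟨v, hv⟩
  have hab : Subgroup.closure ({a, b} : Set K) = ⊤ := by
    have : ({a, b} : Set K) = ((↑) : K → P) ⁻¹' {s, v} := by
      ext z
      simp [a, b, Subtype.ext_iff]
    rw [this]
    exact Subgroup.closure_closure_coe_preimage
  refine ⟨K, inferInstance, a, b, hab, fun i => ?_⟩
  let Y : Finset K := {a, b}
  have hY : Generates Y := by
    rw [Generates]
    simpa [Y] using hab
  -- the embedding
  let Φ : G i →* P := (MonoidHom.mulSingle (fun i => Equiv.Perm (ℤ × ℤ × G i)) i).comp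
    (deltaPerm (G i))
  have hΦi : ∀ g, Φ g i = deltaPerm (G i) g := fun g => by simp [Φ]
  have hΦmem : ∀ g, Φ g ∈ K := by
    have : Subgroup.closure (X i : Set (G i)) ≤ K.comap Φ := by
      rw [Subgroup.closure_le]
      intro x hx
      rw [← he] at hx
      obtain ⟨j, rfl⟩ := hx
      set n := 2 * Nat.pair i j + 1 with hn
      have hid : Φ (e i j) = ((s ^ n)⁻¹ * v * s ^ n) * v * ((s ^ n)⁻¹ * v * s ^ n)⁻¹ * v⁻¹ := by
        funext k
        have := commutator_identity (y k) (hyodd k) n (by omega)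
        rw [hyval] at this
        refine Eq.trans ?_ this
        by_cases hik : i = k
        · subst hik
          rw [hΦi, if_pos rfl]
        · rw [if_neg hik, map_one]
          exact Pi.mulSingle_eq_of_ne (Ne.symm hik) _
      have hc : (s ^ n)⁻¹ * v * s ^ n ∈ K :=
        K.mul_mem (K.mul_mem (K.inv_mem (K.pow_mem hs n)) hv) (K.pow_mem hs n)
      show Φ (e i j) ∈ K
      rw [hid]
      exact K.mul_mem (K.mul_mem (K.mul_mem hc hv) (K.inv_mem hc)) (K.inv_mem hv)
    intro g
    apply this
    rw [show Subgroup.closure (X i : Set (G i)) = ⊤ from hXgen i]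
    trivial
  let φ : G i →* K := Φ.codRestrict K hΦmem
  have hφi : ∀ g, (φ g : P) i = deltaPerm (G i) g := hΦi
  have hinj : Function.Injective φ := by
    intro g h hgh
    apply deltaPerm_injective
    rw [← hφi, ← hφi, hgh]
  -- every element of `K` is monomial
  have hgood : ∀ h : K, Good (X i) (wordLength Y h) ((h : P) i) := by
    intro h
    obtain ⟨w, h1, h2, h3⟩ := inBall_wordLength hY h
    have key : ∀ w : List K, (∀ z ∈ w, z ∈ Y ∨ z⁻¹ ∈ Y) →
        Good (X i) w.length ((w.prod : P) i) := by
      intro w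
      induction w with
      | nil => intro _; exact good_one
      | cons z w ih =>
        intro hw
        have hz : Good (X i) 1 ((z : P) i) := by
          rcases hw z (by simp) with h | h
          · simp only [Y, Finset.mem_insert, Finset.mem_singleton] at h
            rcases h with rfl | rfl
            · exact good_shift
            · exact good_gen _ (hyX i)
          · simp only [Y, Finset.mem_insert, Finset.mem_singleton] at h
            rcases h with h | h
            · rw [inv_eq_iff_eq_inv] at h
              subst h
              exact good_shift_inv
            · rw [inv_eq_iff_eq_inv] at h
              subst h
              exact good_gen_inv _ (hyX i)
        have := hz.mul (ih fun u hu => hw u (by simp [hu]))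
        rw [List.prod_cons, List.length_cons, add_comm]
        exact this
    have := key w h2
    rw [h3] at this
    intro p q
    obtain ⟨p', q', c, ⟨u, hu, hu'⟩, hc⟩ := this p q
    exact ⟨p', q', c, ⟨u, hu.trans h1, hu'⟩, hc⟩
  refine ⟨X i, Y, φ, hXgen i, hY, ⟨hinj, ?_⟩, hinj, ?_⟩
  · obtain ⟨C, hC⟩ := lipschitz_of_hom (hXgen i) hY φ
    refine ⟨C + 1, 1, by positivity, one_pos, fun g => ⟨?_, ?_⟩⟩
    · have hlow : wordLength (X i) g ≤ wordLength Y (φ g) := by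
        obtain ⟨p', q', c, hc, hg⟩ := hgood (φ g) 0 0
        have := hg 1
        rw [hφi, deltaPerm_apply] at this
        simp at this
        have hgc : g = c := this.2.2
        have hle := hc.wordLength_le
        rwa [← hgc] at hle
      have hlow' : (wordLength (X i) g : ℝ) ≤ wordLength Y (φ g) := by exact_mod_cast hlow
      have h0 : (0 : ℝ) ≤ wordLength (X i) g := by positivity
      have h1 : 1 / ((C : ℝ) + 1) ≤ 1 := by
        rw [div_le_one (by positivity)]
        have : (0 : ℝ) ≤ C := by positivity
        linarith
      nlinarith [mul_le_mul_of_nonneg_right h1 h0]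
    · have h0 : (0 : ℝ) ≤ wordLength (X i) g := by positivity
      have : (wordLength Y (φ g) : ℝ) ≤ C * wordLength (X i) g := by exact_mod_cast hC g
      linarith
  · intro g h
    refine ⟨fun hc => φ.map_isConj hc, fun hc => ?_⟩
    obtain ⟨c, hc⟩ := isConj_iff.1 hc
    apply isConj_of_good (hgood c)
    have hc' : c * φ g = φ h * c := by rw [← hc]; group
    have := congrArg (fun z : K => (z : P) i) hc'
    rw [← hφi, ← hφi]
    exact this
end

section
/- Let (G_i)_{i∈ℕ} be a recursively enumerated family of finitely generated groups with decidable word problem: there are a computable function n : ℕ → ℕ, surjective homomorphisms π_i from the free group on n(i) generators onto G_i, and a computable two-variable predicate deciding for each pair (i, w), where w is a word over the n(i) generators and their inverses, whether π_i(w) = 1 in G_i. Then there exist a group H̃ generated by two elements with decidable word problem and embeddings φ_i : G_i → H̃ that are simultaneously quasi-isometric and Frattini, such that moreover the membership problem for each image φ_i(G_i) in H̃ is decidable. -/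
namespace FamEmb

/-- Binary logarithm by bounded search. -/
def lg (N : ℕ) : ℕ := Nat.findGreatest (fun k => 2 ^ k ≤ N) N

/-- Being a power of two. -/
def On (N : ℕ) : Prop := 2 ^ lg N = N

instance : DecidablePred On := fun N => inferInstanceAs (Decidable (2 ^ lg N = N))

theorem lg_pow (k : ℕ) : lg (2 ^ k) = k := by
  unfold lg
  apply le_antisymm
  · have h := Nat.findGreatest_spec (P := fun j => 2 ^ j ≤ 2 ^ k) (m := 0) (n := 2 ^ k)
      (Nat.zero_le _) (by simpa using Nat.one_le_two_pow)
    exact (Nat.pow_le_pow_iff_right (by norm_num)).1 h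
  · exact Nat.le_findGreatest (Nat.lt_two_pow_self).le le_rfl

theorem on_pow (k : ℕ) : On (2 ^ k) := by
  unfold On; rw [lg_pow]

theorem on_iff (N : ℕ) : On N ↔ ∃ k, N = 2 ^ k :=
  ⟨fun h => ⟨lg N, h.symm⟩, by rintro ⟨k, rfl⟩; exact on_pow k⟩

/-- The letter which is output at position `N`. -/
def emt (ni i N : ℕ) (b : Bool) : List (ℕ × Bool) :=
  if lg N ≠ 0 ∧ (Nat.unpair (lg N - 1)).1 = i ∧ (Nat.unpair (lg N - 1)).2 < ni then
    [((Nat.unpair (lg N - 1)).2, b)] else []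

theorem emt_pow (ni i j : ℕ) (hj : j < ni) (b : Bool) :
    emt ni i (2 ^ (Nat.pair i j + 1)) b = [(j, b)] := by
  simp [emt, lg_pow, hj]

theorem emt_pow_ne (ni i i' j : ℕ) (h : i ≠ i') (b : Bool) :
    emt ni i' (2 ^ (Nat.pair i j + 1)) b = [] := by
  simp [emt, lg_pow, h]

theorem emt_one (ni i : ℕ) (b : Bool) : emt ni i 1 b = [] := by
  have := lg_pow 0
  simp at this
  simp [emt, this]

theorem emt_large (ni i N : ℕ) (b : Bool) (h : N ≤ i) : emt ni i N b = [] := by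
  unfold emt
  rw [if_neg]
  rintro ⟨h1, h2, -⟩
  have h3 : lg N ≤ N := Nat.findGreatest_le N
  have h4 := Nat.unpair_left_le (lg N - 1)
  omega

theorem emt_lt (ni i N : ℕ) (b : Bool) : ∀ p ∈ emt ni i N b, p.1 < ni := by
  intro p hp
  unfold emt at hp
  split_ifs at hp with h
  · simp at hp; subst hp; exact h.2.2
  · simp at hp

section K
variable {K : Type} [Group K]

theorem evalWord_nil (x : ℕ → K) : evalWord x [] = 1 := by simp [evalWord]

theorem evalWord_append (x : ℕ → K) (v v' : List (ℕ × Bool)) :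
    evalWord x (v ++ v') = evalWord x v * evalWord x v' := by simp [evalWord]

theorem evalWord_emt_false (x : ℕ → K) (ni i N : ℕ) :
    evalWord x (emt ni i N false) = (evalWord x (emt ni i N true))⁻¹ := by
  unfold emt
  split_ifs <;> simp [evalWord]

/-- The shift. -/
def sPerm (K : Type) : Equiv.Perm (ℤ × ℤ × K) where
  toFun p := (p.1 + 1, p.2)
  invFun p := (p.1 - 1, p.2)
  left_inv p := by simp
  right_inv p := by simp

/-- The second generator. -/
def fPerm (y : ℕ → K) : Equiv.Perm (ℤ × ℤ × K) where
  toFun p := if On p.1.toNat then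
    (p.1, p.2.1 + 1, (if 0 ≤ p.2.1 then y p.1.toNat else 1) * p.2.2) else p
  invFun p := if On p.1.toNat then
    (p.1, p.2.1 - 1, (if 0 ≤ p.2.1 - 1 then (y p.1.toNat)⁻¹ else 1) * p.2.2) else p
  left_inv p := by
    obtain ⟨n, m, g⟩ := p
    dsimp only
    by_cases h : On n.toNat <;> by_cases h2 : 0 ≤ m <;> simp [h, h2]
  right_inv p := by
    obtain ⟨n, m, g⟩ := p
    dsimp only
    by_cases h : On n.toNat <;> by_cases h2 : 1 ≤ m <;> simp [h, h2]

/-- The action of the free group. -/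
def act (y : ℕ → K) : FreeGroup (Fin 2) →* Equiv.Perm (ℤ × ℤ × K) :=
  FreeGroup.lift ![sPerm K, fPerm y]

/-- Exponent of a letter as a sign. -/
def sg (b : Bool) : ℤ := if b then 1 else -1

/-- Total shift. -/
def sexp : List (Fin 2 × Bool) → ℤ
  | [] => 0
  | l :: w => sexp w + if l.1 = 0 then sg l.2 else 0

/-- Displacement of the second coordinate. -/
def disp : List (Fin 2 × Bool) → ℤ → ℤ
  | [], _ => 0
  | l :: w, n => disp w n + if l.1 ≠ 0 ∧ On (n + sexp w).toNat then sg l.2 else 0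

/-- Factor contributed by a letter. -/
def fac (y : ℕ → K) (b : Bool) (N : ℕ) (m : ℤ) : K :=
  if b then (if 0 ≤ m then y N else 1) else (if 0 ≤ m - 1 then (y N)⁻¹ else 1)

/-- The group component. -/
def U (y : ℕ → K) : List (Fin 2 × Bool) → ℤ → ℤ → K
  | [], _, _ => 1
  | l :: w, n, m => (if l.1 ≠ 0 ∧ On (n + sexp w).toNat then
      fac y l.2 (n + sexp w).toNat (m + disp w n) else 1) * U y w n m

/-- The permutation of a letter. -/
def letterPerm (y : ℕ → K) (l : Fin 2 × Bool) : Equiv.Perm (ℤ × ℤ × K) :=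
  cond l.2 (![sPerm K, fPerm y] l.1) (![sPerm K, fPerm y] l.1)⁻¹

theorem letterPerm_apply (y : ℕ → K) (l : Fin 2 × Bool) (n m : ℤ) (g : K) :
    letterPerm y l (n, m, g) = (n + (if l.1 = 0 then sg l.2 else 0),
      m + (if l.1 ≠ 0 ∧ On n.toNat then sg l.2 else 0),
      (if l.1 ≠ 0 ∧ On n.toNat then fac y l.2 n.toNat m else 1) * g) := by
  obtain ⟨k, b⟩ := l
  fin_cases k <;> cases b
  · simp only [letterPerm, sg, Equiv.Perm.inv_def]
    simp [sPerm, sub_eq_add_neg]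
  · simp [letterPerm, sPerm, sg]
  · simp only [letterPerm, sg, Equiv.Perm.inv_def]
    by_cases h : On n.toNat <;> simp [fPerm, fac, h, sub_eq_add_neg]
  · by_cases h : On n.toNat <;> simp [letterPerm, fPerm, fac, sg, h]

theorem act_cons (y : ℕ → K) (l : Fin 2 × Bool) (w : List (Fin 2 × Bool)) :
    act y (FreeGroup.mk (l :: w)) = letterPerm y l * act y (FreeGroup.mk w) := by
  simp [act, letterPerm]

theorem act_nil (y : ℕ → K) : act y (FreeGroup.mk []) = 1 := by
  simp [act]

theorem act_mk (y : ℕ → K) (w : List (Fin 2 × Bool)) (n m : ℤ) (g : K) :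
    act y (FreeGroup.mk w) (n, m, g) = (n + sexp w, m + disp w n, U y w n m * g) := by
  induction w with
  | nil => simp [act_nil, sexp, disp, U]
  | cons l w ih =>
    rw [act_cons, Equiv.Perm.mul_apply, ih, letterPerm_apply]
    simp only [sexp, disp, U, add_assoc, mul_assoc]

theorem sg_abs (b : Bool) : -1 ≤ sg b ∧ sg b ≤ 1 := by cases b <;> simp [sg]

theorem sexp_bound (w : List (Fin 2 × Bool)) : -(w.length : ℤ) ≤ sexp w ∧ sexp w ≤ w.length := by
  induction w with
  | nil => simp [sexp]
  | cons l w ih =>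
    have := sg_abs l.2
    simp only [sexp, List.length_cons]
    split_ifs <;> push_cast <;> omega

theorem disp_bound (w : List (Fin 2 × Bool)) (n : ℤ) :
    -(w.length : ℤ) ≤ disp w n ∧ disp w n ≤ w.length := by
  induction w with
  | nil => simp [disp]
  | cons l w ih =>
    have := sg_abs l.2
    simp only [disp, List.length_cons]
    split_ifs <;> push_cast <;> omega

theorem fac_pos (y : ℕ → K) (b : Bool) (N : ℕ) (m m' : ℤ) (h : 1 ≤ m) (h' : 1 ≤ m') :
    fac y b N m = fac y b N m' := by
  have h1 : 0 ≤ m := by omega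
  have h2 : 0 ≤ m' := by omega
  simp [fac, h, h', h1, h2]

theorem fac_neg (y : ℕ → K) (b : Bool) (N : ℕ) (m : ℤ) (h : m < 0) :
    fac y b N m = 1 := by
  have h1 : ¬ 0 ≤ m := by omega
  have h2 : ¬ 1 ≤ m := by omega
  simp [fac, h1, h2]

theorem U_pos (y : ℕ → K) (w : List (Fin 2 × Bool)) (n m m' : ℤ) (h : w.length ≤ m)
    (h' : w.length ≤ m') : U y w n m = U y w n m' := by
  induction w with
  | nil => simp [U]
  | cons l w ih =>
    simp only [List.length_cons] at h h'
    push_cast at h h'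
    have hd := disp_bound w n
    simp only [U]
    rw [ih (by omega) (by omega), fac_pos y l.2 _ (m + disp w n) (m' + disp w n) (by omega)
      (by omega)]

theorem U_neg (y : ℕ → K) (w : List (Fin 2 × Bool)) (n m : ℤ) (h : m ≤ -(w.length : ℤ)) :
    U y w n m = 1 := by
  induction w with
  | nil => simp [U]
  | cons l w ih =>
    simp only [List.length_cons] at h
    push_cast at h
    have hd := disp_bound w n
    simp only [U]
    rw [ih (by omega), fac_neg y l.2 _ (m + disp w n) (by omega)]
    simp

theorem U_triv (y : ℕ → K) (w : List (Fin 2 × Bool)) (n m : ℤ)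
    (h : ∀ N : ℕ, (N : ℤ) ≤ max 0 (n + w.length) → y N = 1) : U y w n m = 1 := by
  induction w with
  | nil => simp [U]
  | cons l w ih =>
    have hd := sexp_bound w
    simp only [List.length_cons] at h
    push_cast at h
    simp only [U]
    rw [ih (fun N hN => h N (by omega))]
    have : y (n + sexp w).toNat = 1 := h _ (by omega)
    simp [fac, this]

theorem disp_congr (w : List (Fin 2 × Bool)) (n n' : ℤ)
    (h : ∀ j : ℤ, -(w.length : ℤ) ≤ j → j ≤ w.length →
      (On (n + j).toNat ↔ On (n' + j).toNat)) : disp w n = disp w n' := by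
  induction w with
  | nil => simp [disp]
  | cons l w ih =>
    have hd := sexp_bound w
    simp only [List.length_cons] at h
    push_cast at h
    simp only [disp]
    rw [ih (fun j h1 h2 => h j (by omega) (by omega))]
    simp only [h (sexp w) (by omega) (by omega)]

/-- If at most one position is hit, the group component is determined by the displacement. -/
theorem U_isolated (y : ℕ → K) (w : List (Fin 2 × Bool)) (n m : ℤ) (p : ℕ)
    (h : ∀ j : ℤ, -(w.length : ℤ) ≤ j → j ≤ w.length → On (n + j).toNat → (n + j).toNat = p) :
    U y w n m = y p ^ (m + disp w n).toNat * (y p ^ m.toNat)⁻¹ := by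
  induction w with
  | nil => simp [U, disp]
  | cons l w ih =>
    have hd := sexp_bound w
    simp only [List.length_cons] at h
    push_cast at h
    simp only [U, disp]
    rw [ih (fun j h1 h2 => h j (by omega) (by omega))]
    by_cases hc : l.1 ≠ 0 ∧ On (n + sexp w).toNat
    · rw [if_pos hc, if_pos hc, h (sexp w) (by omega) (by omega) hc.2, ← mul_assoc]
      congr 1
      generalize disp w n = e
      cases hb : l.2
      · by_cases h1 : 0 ≤ m + e - 1
        · have : (m + e).toNat = (m + (e + sg false)).toNat + 1 := by simp [sg]; omega
          rw [this, pow_succ']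
          simp only [fac, h1]
          simp
        · have h2 : (m + e).toNat = 0 := by omega
          have : (m + (e + sg false)).toNat = 0 := by simp [sg]; omega
          rw [this, h2]
          simp [fac]; omega
      · by_cases h1 : 0 ≤ m + e
        · have : (m + (e + sg true)).toNat = (m + e).toNat + 1 := by simp [sg]; omega
          rw [this, pow_succ']
          simp only [fac, h1]
          simp
        · have h2 : (m + e).toNat = 0 := by omega
          have : (m + (e + sg true)).toNat = 0 := by simp [sg]; omega
          rw [this, h2]
          simp [fac]; omega
    · rw [if_neg hc, if_neg hc]
      simp
end K

theorem pow_gap (a b : ℕ) (h : 2 ^ a < 2 ^ b) : 2 * 2 ^ a ≤ 2 ^ b := by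
  have h1 : a < b := (Nat.pow_lt_pow_iff_right (by norm_num)).1 h
  have : 2 ^ (a + 1) ≤ 2 ^ b := Nat.pow_le_pow_right (by norm_num) h1
  rw [pow_succ] at this
  omega

/-- Positions far from the origin are isolated. -/
theorem isolated (L : ℕ) (n : ℤ) (h : 3 * (L : ℤ) < n) (j j' : ℤ) (h1 : -(L : ℤ) ≤ j) (h2 : j ≤ L)
    (h3 : -(L : ℤ) ≤ j') (h4 : j' ≤ L) (hj : On (n + j).toNat) (hj' : On (n + j').toNat) :
    j = j' := by
  obtain ⟨a, ha⟩ := (on_iff _).1 hj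
  obtain ⟨b, hb⟩ := (on_iff _).1 hj'
  rcases lt_trichotomy (2 ^ a) (2 ^ b) with hl | hl | hl
  · have := pow_gap a b hl
    omega
  · omega
  · have := pow_gap b a hl
    omega

theorem not_on_zero : ¬ On 0 := by
  rw [on_iff]; rintro ⟨k, hk⟩
  have := Nat.one_le_two_pow (n := k)
  omega

end FamEmb
namespace FamEmb

/-- Bound for the search. -/
def bd (w : List (Fin 2 × Bool)) : ℕ := 2 ^ (w.length + 4)

theorem bd_large (w : List (Fin 2 × Bool)) : 16 * (w.length + 1) ≤ bd w := by
  have : w.length < 2 ^ w.length := Nat.lt_two_pow_self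
  unfold bd
  rw [pow_add]
  omega

/-- The word acts trivially, except possibly at one copy of one group. -/
def Good {G : ℕ → Type} [∀ i, Group (G i)] (y : ∀ i, ℕ → G i) (w : List (Fin 2 × Bool))
    (E : ℕ) : Prop :=
  sexp w = 0 ∧ (∀ n, disp w n = 0) ∧
    ∀ i n m, (i + 1 = E ∧ n = 1 ∧ m = 0) ∨ U (y i) w n m = 1

theorem reduction {G : ℕ → Type} [∀ i, Group (G i)] (y : ∀ i, ℕ → G i)
    (hy : ∀ i N, N ≤ i → y i N = 1) (w : List (Fin 2 × Bool)) (E : ℕ)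
    (H : ∀ i < bd w, ∀ a < bd w, ∀ b < bd w, ∀ c < bd w, ∀ d < bd w,
      sexp w = 0 ∧ disp w ((a : ℤ) - b) = 0 ∧
        ((i + 1 = E ∧ a = b + 1 ∧ c = d) ∨ U (y i) w ((a : ℤ) - b) ((c : ℤ) - d) = 1)) :
    Good y w E := by
  have hB := bd_large w
  have H' : ∀ (i : ℕ) (n m : ℤ), i < bd w → -(bd w : ℤ) < n → n < bd w → -(bd w : ℤ) < m →
      m < bd w → sexp w = 0 ∧ disp w n = 0 ∧
        ((i + 1 = E ∧ n = 1 ∧ m = 0) ∨ U (y i) w n m = 1) := by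
    intro i n m hi h1 h2 h3 h4
    have h := H i hi n.toNat (by omega) (-n).toNat (by omega) m.toNat (by omega)
      (-m).toNat (by omega)
    have e1 : ((n.toNat : ℤ) - (-n).toNat) = n := by omega
    have e2 : ((m.toNat : ℤ) - (-m).toNat) = m := by omega
    rw [e1, e2] at h
    refine ⟨h.1, h.2.1, h.2.2.imp ?_ id⟩
    rintro ⟨a1, a2, a3⟩
    exact ⟨a1, by omega, by omega⟩
  clear H
  have hs : sexp w = 0 := (H' 0 0 0 (by omega) (by omega) (by omega) (by omega) (by omega)).1
  have hd0 : ∀ n : ℤ, -(bd w : ℤ) < n → n < bd w → disp w n = 0 := fun n h1 h2 =>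
    (H' 0 n 0 (by omega) h1 h2 (by omega) (by omega)).2.1
  have hneg : ∀ n : ℤ, n < -(w.length : ℤ) → ∀ j : ℤ, j ≤ w.length → ¬ On (n + j).toNat := by
    intro n hn j hj
    have : (n + j).toNat = 0 := by omega
    rw [this]
    exact not_on_zero
  have hpow : bd w = 2 * 2 ^ (w.length + 3) := by unfold bd; rw [pow_succ]; ring
  have hd : ∀ n, disp w n = 0 := by
    intro n
    by_cases h1 : n < -(w.length : ℤ)
    · rw [disp_congr w n (-(w.length : ℤ) - 1)]
      · exact hd0 _ (by omega) (by omega)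
      · intro j _ h3
        simp only [hneg n h1 j h3, hneg (-(w.length : ℤ) - 1) (by omega) j h3]
    by_cases h2 : n ≤ 3 * (w.length : ℤ)
    · exact hd0 _ (by omega) (by omega)
    push Not at h1 h2
    by_cases h3 : ∃ j : ℤ, -(w.length : ℤ) ≤ j ∧ j ≤ w.length ∧ On (n + j).toNat
    · obtain ⟨j, hj1, hj2, hj3⟩ := h3
      set n' : ℤ := ((2 ^ (w.length + 3) : ℕ) : ℤ) - j with hn'
      have hon : On (n' + j).toNat := by
        have : (n' + j).toNat = 2 ^ (w.length + 3) := by omega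
        rw [this]
        exact on_pow _
      rw [disp_congr w n n']
      · exact hd0 _ (by omega) (by omega)
      · intro j' h4 h5
        constructor
        · intro h6
          rw [← isolated w.length n h2 j j' hj1 hj2 h4 h5 hj3 h6]
          exact hon
        · intro h6
          rw [← isolated w.length n' (by omega) j j' hj1 hj2 h4 h5 hon h6]
          exact hj3
    · push Not at h3
      rw [disp_congr w n (-(w.length : ℤ) - 1)]
      · exact hd0 _ (by omega) (by omega)
      · intro j h4 h5
        simp only [h3 j h4 h5, hneg (-(w.length : ℤ) - 1) (by omega) j h5]
  refine ⟨hs, hd, ?_⟩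
  intro i n m
  by_cases h1 : n < -(w.length : ℤ)
  · right
    rw [U_isolated (y i) w n m 0 (fun j _ h3 h4 => absurd h4 (hneg n h1 j h3)), hd]
    simp
  by_cases h2 : n ≤ 3 * (w.length : ℤ)
  · by_cases h3 : i < bd w
    · by_cases h4 : m ≤ w.length
      · by_cases h5 : -(w.length : ℤ) ≤ m
        · exact (H' i n m h3 (by omega) (by omega) (by omega) (by omega)).2.2
        · right
          exact U_neg _ _ _ _ (by omega)
      · right
        rw [U_pos (y i) w n m (w.length + 1) (by omega) (by omega)]
        rcases (H' i n (w.length + 1) h3 (by omega) (by omega) (by omega) (by omega)).2.2 with h | h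
        · omega
        · exact h
    · right
      exact U_triv _ _ _ _ (fun N hN => hy i N (by omega))
  · right
    push Not at h1 h2
    by_cases h3 : ∃ j : ℤ, -(w.length : ℤ) ≤ j ∧ j ≤ w.length ∧ On (n + j).toNat
    · obtain ⟨j, hj1, hj2, hj3⟩ := h3
      rw [U_isolated (y i) w n m (n + j).toNat, hd]
      · simp
      · intro j' h4 h5 h6
        rw [isolated w.length n h2 j j' hj1 hj2 h4 h5 hj3 h6]
    · push Not at h3
      rw [U_isolated (y i) w n m 0 (fun j h4 h5 h6 => absurd h6 (h3 j h4 h5)), hd]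
      simp

section K
variable {K : Type} [Group K]

/-- Left multiplication on the copy of `K` at `(1, 0)`. -/
def dl (K : Type) [Group K] : K →* Equiv.Perm (ℤ × ℤ × K) where
  toFun g :=
    { toFun := fun p => if p.1 = 1 ∧ p.2.1 = 0 then (p.1, p.2.1, g * p.2.2) else p
      invFun := fun p => if p.1 = 1 ∧ p.2.1 = 0 then (p.1, p.2.1, g⁻¹ * p.2.2) else p
      left_inv := by
        rintro ⟨n, m, h⟩
        by_cases hc : n = 1 ∧ m = 0 <;> simp [hc]
      right_inv := by
        rintro ⟨n, m, h⟩
        by_cases hc : n = 1 ∧ m = 0 <;> simp [hc] }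
  map_one' := by
    ext1 ⟨n, m, h⟩
    simp
  map_mul' g g' := by
    ext1 ⟨n, m, h⟩
    by_cases hc : n = 1 ∧ m = 0 <;> simp [hc, mul_assoc]

theorem dl_apply (g : K) (n m : ℤ) (h : K) :
    dl K g (n, m, h) = if n = 1 ∧ m = 0 then (n, m, g * h) else (n, m, h) := rfl

/-- The conjugated generator. -/
def fw (d : ℕ) : FreeGroup (Fin 2) :=
  (FreeGroup.of 0 ^ d)⁻¹ * FreeGroup.of 1 * FreeGroup.of 0 ^ d

/-- The element representing a generator. -/
def uw (k : ℕ) : FreeGroup (Fin 2) :=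
  (FreeGroup.of 1)⁻¹ * fw (2 ^ k - 1) * FreeGroup.of 1 * (fw (2 ^ k - 1))⁻¹

theorem act_s_pow (y : ℕ → K) (d : ℕ) (n : ℤ) (z : ℤ × K) :
    act y (FreeGroup.of 0 ^ d) (n, z) = (n + d, z) := by
  induction d generalizing n with
  | zero => simp
  | succ d ih =>
    rw [pow_succ, map_mul, Equiv.Perm.mul_apply]
    have : act y (FreeGroup.of 0) (n, z) = (n + 1, z) := by simp [act, sPerm]
    rw [this, ih]
    push_cast
    congr 1
    ring

theorem act_s_pow_inv (y : ℕ → K) (d : ℕ) (n : ℤ) (z : ℤ × K) :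
    act y (FreeGroup.of 0 ^ d)⁻¹ (n, z) = (n - d, z) := by
  rw [map_inv, Equiv.Perm.inv_eq_iff_eq, act_s_pow]
  simp

theorem act_f (y : ℕ → K) (n m : ℤ) (g : K) :
    act y (FreeGroup.of 1) (n, m, g) = if On n.toNat then
      (n, m + 1, (if 0 ≤ m then y n.toNat else 1) * g) else (n, m, g) := by
  simp [act, fPerm]

theorem act_f_inv (y : ℕ → K) (n m : ℤ) (g : K) :
    act y (FreeGroup.of 1)⁻¹ (n, m, g) = if On n.toNat then
      (n, m - 1, (if 0 ≤ m - 1 then (y n.toNat)⁻¹ else 1) * g) else (n, m, g) := by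
  rw [map_inv, Equiv.Perm.inv_def]
  simp [act, fPerm]

theorem act_fw (y : ℕ → K) (d : ℕ) (n m : ℤ) (g : K) :
    act y (fw d) (n, m, g) = if On (n + d).toNat then
      (n, m + 1, (if 0 ≤ m then y (n + d).toNat else 1) * g) else (n, m, g) := by
  rw [fw, map_mul, map_mul, Equiv.Perm.mul_apply, Equiv.Perm.mul_apply, act_s_pow, act_f]
  split_ifs <;> rw [act_s_pow_inv] <;> simp

theorem act_fw_inv (y : ℕ → K) (d : ℕ) (n m : ℤ) (g : K) :
    act y (fw d)⁻¹ (n, m, g) = if On (n + d).toNat then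
      (n, m - 1, (if 0 ≤ m - 1 then (y (n + d).toNat)⁻¹ else 1) * g) else (n, m, g) := by
  have : (fw d)⁻¹ = (FreeGroup.of 0 ^ d)⁻¹ * (FreeGroup.of 1)⁻¹ * FreeGroup.of 0 ^ d := by
    simp only [fw]; group
  rw [this, map_mul, map_mul, Equiv.Perm.mul_apply, Equiv.Perm.mul_apply, act_s_pow, act_f_inv]
  split_ifs <;> rw [act_s_pow_inv] <;> simp

theorem pow_diff (k : ℕ) (n : ℤ) (h1 : On n.toNat)
    (h2 : On (n + ((2 ^ (k + 1) - 1 : ℕ) : ℤ)).toNat) : n = 1 := by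
  obtain ⟨a, ha⟩ := (on_iff _).1 h1
  obtain ⟨b, hb⟩ := (on_iff _).1 h2
  have h3 : 1 ≤ 2 ^ a := Nat.one_le_two_pow
  have h4 : 1 ≤ 2 ^ k := Nat.one_le_two_pow
  rw [pow_succ] at hb
  cases a with
  | zero => rw [pow_zero] at ha; omega
  | succ a =>
    rw [pow_succ] at ha
    cases b with
    | zero => rw [pow_zero] at hb; omega
    | succ b => rw [pow_succ] at hb; omega

theorem act_uw (y : ℕ → K) (hy : y 1 = 1) (k : ℕ) :
    act y (uw (k + 1)) = dl K (y (2 ^ (k + 1))) := by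
  ext1 ⟨n, m, g⟩
  rw [uw, map_mul, map_mul, map_mul, Equiv.Perm.mul_apply, Equiv.Perm.mul_apply,
    Equiv.Perm.mul_apply, act_fw_inv, dl_apply]
  by_cases h1 : On n.toNat
  · by_cases h2 : On (n + ((2 ^ (k + 1) - 1 : ℕ) : ℤ)).toNat
    · obtain rfl := pow_diff k n h1 h2
      have h4 : 1 ≤ 2 ^ (k + 1) := Nat.one_le_two_pow
      have h3 : ((1 : ℤ) + ((2 ^ (k + 1) - 1 : ℕ) : ℤ)).toNat = 2 ^ (k + 1) := by omega
      have h5 : (1 : ℤ).toNat = 1 := rfl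
      rw [if_pos h2, act_f, if_pos h1, act_fw, if_pos h2, act_f_inv, if_pos h1, h3, h5, hy]
      rcases lt_trichotomy m 0 with hm | rfl | hm
      · have a1 : ¬ (0 ≤ m - 1) := by omega
        have a2 : ¬ (0 ≤ m) := by omega
        have a3 : m ≠ 0 := by omega
        simp [a2, a3]
        omega
      · simp
      · have a1 : 1 ≤ m := by omega
        have a2 : (0 ≤ m) := by omega
        have a3 : m ≠ 0 := by omega
        simp [a1, a2, a3]
    · have h3 : ¬ n = 1 := by
        rintro rfl
        apply h2
        have h4 : 1 ≤ 2 ^ (k + 1) := Nat.one_le_two_pow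
        have h3 : ((1 : ℤ) + ((2 ^ (k + 1) - 1 : ℕ) : ℤ)).toNat = 2 ^ (k + 1) := by omega
        rw [h3]
        exact on_pow _
      rw [if_neg h2, act_f, if_pos h1, act_fw, if_neg h2, act_f_inv, if_pos h1]
      by_cases hm : 0 ≤ m <;> simp [h3, hm]
  · have h3 : ¬ n = 1 := by
      rintro rfl
      exact h1 (on_pow 0)
    by_cases h2 : On (n + ((2 ^ (k + 1) - 1 : ℕ) : ℤ)).toNat
    · rw [if_pos h2, act_f, if_neg h1, act_fw, if_pos h2, act_f_inv, if_neg h1]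
      by_cases hm : 1 ≤ m <;> simp [h3, hm]
    · rw [if_neg h2, act_f, if_neg h1, act_fw, if_neg h2, act_f_inv, if_neg h1]
      simp [h3]

end K
end FamEmb
namespace FamEmb

section family
variable (n : ℕ → ℕ) {G : ℕ → Type} [∀ i, Group (G i)]
    (π : ∀ i, FreeGroup (Fin (n i)) →* G i)

/-- Generators of the groups. -/
def xv (i j : ℕ) : G i := if h : j < n i then π i (FreeGroup.of ⟨j, h⟩) else 1

/-- Elements at the positions. -/
def yv (i N : ℕ) : G i := evalWord (xv n π i) (emt (n i) i N true)

theorem yv_one (i : ℕ) : yv n π i 1 = 1 := by simp [yv, emt_one, evalWord_nil]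

theorem yv_large (i N : ℕ) (h : N ≤ i) : yv n π i N = 1 := by
  simp [yv, emt_large _ _ _ _ h, evalWord_nil]

theorem yv_pow (i : ℕ) (j : Fin (n i)) :
    yv n π i (2 ^ (Nat.pair i j + 1)) = π i (FreeGroup.of j) := by
  simp [yv, emt_pow _ _ _ j.2, evalWord, xv]

theorem yv_pow_ne (i i' j : ℕ) (h : i ≠ i') : yv n π i' (2 ^ (Nat.pair i j + 1)) = 1 := by
  simp [yv, emt_pow_ne _ _ _ _ h, evalWord]

/-- Values at positions are trivial or generators. -/
theorem yv_cases (i N : ℕ) : yv n π i N = 1 ∨ ∃ j, yv n π i N = π i (FreeGroup.of j) := by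
  unfold yv emt
  split_ifs with h
  · right
    exact ⟨⟨_, h.2.2⟩, by simp [evalWord, xv, h.2.2]⟩
  · left; simp [evalWord]

/-- The representation. -/
def rho0 : FreeGroup (Fin 2) →* (∀ i, Equiv.Perm (ℤ × ℤ × G i)) :=
  MonoidHom.pi fun i => act (yv n π i)

theorem rho0_apply (w : FreeGroup (Fin 2)) (i : ℕ) : rho0 n π w i = act (yv n π i) w := rfl

/-- The embedding into the ambient group. -/
def Phi (G : ℕ → Type) [∀ i, Group (G i)] (i : ℕ) :
    G i →* (∀ i, Equiv.Perm (ℤ × ℤ × G i)) :=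
  (MonoidHom.mulSingle (fun i => Equiv.Perm (ℤ × ℤ × G i)) i).comp (dl (G i))

theorem Phi_same (i : ℕ) (g : G i) : Phi G i g i = dl (G i) g := by
  simp [Phi]

theorem Phi_ne (i i' : ℕ) (h : i ≠ i') (g : G i) : Phi G i g i' = 1 := by
  simp [Phi, Pi.mulSingle_eq_of_ne (Ne.symm h)]

/-- Lifting words. -/
def psi (i : ℕ) : FreeGroup (Fin (n i)) →* FreeGroup (Fin 2) :=
  FreeGroup.lift fun j => uw (Nat.pair i j + 1)

theorem rho0_psi (i : ℕ) (v : FreeGroup (Fin (n i))) :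
    rho0 n π (psi n i v) = Phi G i (π i v) := by
  have : (rho0 n π).comp (psi n i) = (Phi G i).comp (π i) := by
    apply FreeGroup.ext_hom
    intro j
    funext i'
    simp only [MonoidHom.comp_apply, rho0_apply, psi, FreeGroup.lift_apply_of]
    rw [act_uw _ (yv_one n π i')]
    by_cases h : i = i'
    · subst h
      rw [yv_pow, Phi_same]
    · rw [yv_pow_ne _ _ _ _ _ h, Phi_ne _ _ h, map_one]
  exact DFunLike.congr_fun this v

theorem Phi_mem (hπ : ∀ i, Function.Surjective (π i)) (i : ℕ) (g : G i) :
    Phi G i g ∈ (rho0 n π).range := by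
  obtain ⟨v, rfl⟩ := hπ i g
  exact ⟨psi n i v, rho0_psi n π i v⟩

/-- The embedding. -/
def phi (hπ : ∀ i, Function.Surjective (π i)) (i : ℕ) : G i →* (rho0 n π).range :=
  (Phi G i).codRestrict _ (Phi_mem n π hπ i)

theorem phi_val (hπ : ∀ i, Function.Surjective (π i)) (i : ℕ) (g : G i) :
    ((phi n π hπ i g : (rho0 n π).range) : ∀ i, Equiv.Perm (ℤ × ℤ × G i)) = Phi G i g := rfl

theorem Phi_injective (i : ℕ) : Function.Injective (Phi G i) := by
  intro a b h
  have h1 := congrFun h i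
  rw [Phi_same, Phi_same] at h1
  have h2 := DFunLike.congr_fun h1 ((1 : ℤ), (0 : ℤ), (1 : G i))
  simpa [dl_apply] using h2

theorem phi_injective (hπ : ∀ i, Function.Surjective (π i)) (i : ℕ) :
    Function.Injective (phi n π hπ i) := by
  intro a b h
  exact Phi_injective i (congrArg Subtype.val h)

theorem rho0_mk_eq_one_iff (w : List (Fin 2 × Bool)) :
    rho0 n π (FreeGroup.mk w) = 1 ↔ Good (yv n π) w 0 := by
  constructor
  · intro h
    have h1 : ∀ i (k m : ℤ), (k, m, (1 : G i)) =
        (k + sexp w, m + disp w k, U (yv n π i) w k m * 1) := by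
      intro i k m
      rw [← act_mk, ← rho0_apply, h]
      rfl
    simp only [Prod.mk.injEq] at h1
    refine ⟨?_, ?_, ?_⟩
    · have := (h1 0 0 0).1; omega
    · intro k
      have := (h1 0 k 0).2.1; omega
    · intro i k m
      right
      simpa using (h1 i k m).2.2.symm
  · rintro ⟨h1, h2, h3⟩
    funext i
    ext1 ⟨k, m, g⟩
    rw [rho0_apply, act_mk, h1, h2]
    rcases h3 i k m with h | h
    · omega
    · simp [h]

theorem rho0_mk_mem_iff (i : ℕ) (w : List (Fin 2 × Bool)) :
    (∃ g, Phi G i g = rho0 n π (FreeGroup.mk w)) ↔ Good (yv n π) w (i + 1) := by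
  constructor
  · rintro ⟨g, h⟩
    have h1 : ∀ i' (k m : ℤ), Phi G i g i' (k, m, (1 : G i')) =
        (k + sexp w, m + disp w k, U (yv n π i') w k m * 1) := by
      intro i k m
      rw [← act_mk, ← rho0_apply, h]
    have h2 : ∀ i' (k m : ℤ), (i' + 1 = i + 1 ∧ k = 1 ∧ m = 0) ∨ 
        (k, m, (1 : G i')) = (k + sexp w, m + disp w k, U (yv n π i') w k m * 1) := by
      intro i' k m
      rw [← h1]
      by_cases hi : i = i'
      · subst hi
        by_cases hc : k = 1 ∧ m = 0
        · left; exact ⟨rfl, hc⟩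
        · right
          rw [Phi_same, dl_apply, if_neg hc]
      · right
        rw [Phi_ne _ _ hi]
        rfl
    simp only [Prod.mk.injEq] at h2
    refine ⟨?_, ?_, ?_⟩
    · rcases h2 i 0 0 with h | h
      · omega
      · have := h.1; omega
    · intro k
      rcases h2 i k 1 with h | h
      · omega
      · have := h.2.1; omega
    · intro i' k m
      exact (h2 i' k m).imp id (fun h => by simpa using h.2.2.symm)
  · rintro ⟨h1, h2, h3⟩
    refine ⟨U (yv n π i) w 1 0, ?_⟩
    funext i'
    ext1 ⟨k, m, g⟩
    rw [rho0_apply, act_mk, h1, h2]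
    by_cases hi : i = i'
    · subst hi
      rw [Phi_same, dl_apply]
      rcases h3 i k m with h | h
      · obtain ⟨-, rfl, rfl⟩ := h
        simp
      · split_ifs with hc
        · obtain ⟨rfl, rfl⟩ := hc
          simp
        · simp [h]
    · rw [Phi_ne _ _ hi]
      rcases h3 i' k m with h | h
      · omega
      · simp [h]

theorem phi_frattini (hπ : ∀ i, Function.Surjective (π i)) (i : ℕ) :
    IsFrattini (phi n π hπ i) := by
  refine ⟨phi_injective n π hπ i, fun a b => ⟨fun h => MonoidHom.map_isConj _ h, fun h => ?_⟩⟩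
  obtain ⟨⟨c, hc⟩, h⟩ := isConj_iff.1 h
  have h' : c * Phi G i a = Phi G i b * c := by
    have := congrArg Subtype.val h
    simp only [Subgroup.coe_mul, phi_val, InvMemClass.coe_inv] at this
    rw [← this]
    group
  obtain ⟨w, rfl⟩ := hc
  obtain ⟨w, rfl⟩ : ∃ w', FreeGroup.mk w' = w := ⟨w.toWord, FreeGroup.mk_toWord⟩
  have h1 := DFunLike.congr_fun (congrFun h' i) ((1 : ℤ), (0 : ℤ), (1 : G i))
  rw [Pi.mul_apply, Pi.mul_apply, Equiv.Perm.mul_apply, Equiv.Perm.mul_apply, Phi_same, Phi_same,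
    rho0_apply, dl_apply, if_pos ⟨rfl, rfl⟩, act_mk, act_mk, dl_apply] at h1
  split_ifs at h1 with hc
  · simp only [Prod.mk.injEq, mul_one] at h1
    rw [isConj_iff]
    refine ⟨U (yv n π i) w 1 0, ?_⟩
    rw [h1.2.2]
    group
  · simp only [Prod.mk.injEq, mul_one, mul_eq_left, true_and] at h1
    subst h1
    rw [map_one, mul_one] at h'
    have h2 : Phi G i b = 1 := by simpa using h'.symm
    have h3 : b = 1 := Phi_injective i (by rw [h2, map_one])
    rw [h3]

end family

section wl
variable {K : Type} [Group K]

theorem wordLength_spec (X : Finset K) (hX : Generates X) (g : K) :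
    ∃ w : List K, w.length = wordLength X g ∧ (∀ a ∈ w, a ∈ X ∨ a⁻¹ ∈ X) ∧ w.prod = g := by
  apply Nat.sInf_mem (s := {k | ∃ w : List K, w.length = k ∧ (∀ a ∈ w, a ∈ X ∨ a⁻¹ ∈ X) ∧
    w.prod = g})
  have : g ∈ Subgroup.closure (X : Set K) := by
    rw [show Subgroup.closure (X : Set K) = ⊤ from hX]; trivial
  rw [← Subgroup.mem_toSubmonoid, Subgroup.closure_toSubmonoid] at this
  obtain ⟨l, h1, h2⟩ := Submonoid.exists_list_of_mem_closure this
  exact ⟨_, l, rfl, fun a ha => by simpa using h1 a ha, h2⟩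

theorem wordLength_le (X : Finset K) (w : List K) (h : ∀ a ∈ w, a ∈ X ∨ a⁻¹ ∈ X) :
    wordLength X w.prod ≤ w.length := Nat.sInf_le ⟨w, rfl, h, rfl⟩

theorem wordLength_one (X : Finset K) : wordLength X 1 = 0 :=
  Nat.le_zero.1 (wordLength_le X [] (by simp))

theorem wordLength_mul (X : Finset K) (hX : Generates X) (g h : K) :
    wordLength X (g * h) ≤ wordLength X g + wordLength X h := by
  obtain ⟨u, hu1, hu2, hu3⟩ := wordLength_spec X hX g
  obtain ⟨v, hv1, hv2, hv3⟩ := wordLength_spec X hX h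
  have := wordLength_le X (u ++ v) (by
    intro a ha
    rcases List.mem_append.1 ha with ha | ha
    · exact hu2 a ha
    · exact hv2 a ha)
  rw [List.prod_append, hu3, hv3, List.length_append, hu1, hv1] at this
  exact this

theorem wordLength_inv_le (X : Finset K) (hX : Generates X) (g : K) :
    wordLength X g⁻¹ ≤ wordLength X g := by
  obtain ⟨u, hu1, hu2, hu3⟩ := wordLength_spec X hX g
  have := wordLength_le X (u.map (·⁻¹)).reverse (by
    intro a ha
    simp at ha
    rcases hu2 _ ha with h | h
    · right; exact h
    · left; simpa using h)
  rw [← List.prod_inv_reverse, hu3] at this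
  simpa [hu1] using this

theorem wordLength_hom {K' : Type} [Group K'] (X : Finset K) (Y : Finset K') (hX : Generates X)
    (hY : Generates Y) (f : K →* K') :
    ∃ C : ℕ, 0 < C ∧ ∀ g, wordLength Y (f g) ≤ C * wordLength X g := by
  refine ⟨1 + ∑ x ∈ X, wordLength Y (f x), by omega, fun g => ?_⟩
  set C := 1 + ∑ x ∈ X, wordLength Y (f x)
  have hC : ∀ x ∈ X, wordLength Y (f x) ≤ C := fun x hx => by
    have := Finset.single_le_sum (f := fun x => wordLength Y (f x)) (fun _ _ => Nat.zero_le _) hx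
    omega
  obtain ⟨u, hu1, hu2, hu3⟩ := wordLength_spec X hX g
  rw [← hu1, ← hu3]
  clear hu1 hu3
  induction u with
  | nil => simp [wordLength_one]
  | cons a u ih =>
    have h1 := ih (fun b hb => hu2 b (List.mem_cons_of_mem _ hb))
    have h2 : wordLength Y (f a) ≤ C := by
      rcases hu2 a List.mem_cons_self with h | h
      · exact hC a h
      · have := wordLength_inv_le Y hY (f a⁻¹)
        rw [← map_inv, inv_inv] at this
        exact this.trans (hC _ h)
    rw [List.prod_cons, map_mul, List.length_cons, mul_add]
    have := wordLength_mul Y hY (f a) (f u.prod)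
    omega

end wl

section family2
variable (n : ℕ → ℕ) {G : ℕ → Type} [∀ i, Group (G i)]
    (π : ∀ i, FreeGroup (Fin (n i)) →* G i)

open Classical in
/-- Generators of `G i`. -/
noncomputable def XX (i : ℕ) : Finset (G i) :=
  Finset.univ.image fun j => π i (FreeGroup.of j)

open Classical in
/-- Generators of `H`. -/
noncomputable def YY : Finset (rho0 n π).range :=
  Finset.univ.image fun j => (rho0 n π).rangeRestrict (FreeGroup.of j)

theorem gen_image {m : ℕ} {K : Type} [Group K] (f : FreeGroup (Fin m) →* K)
    (hf : Function.Surjective f) (X : Finset K) (hX : ∀ j, f (FreeGroup.of j) ∈ X) :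
    Generates X := by
  unfold Generates
  rw [eq_top_iff]
  rintro g -
  obtain ⟨v, rfl⟩ := hf g
  induction v using FreeGroup.induction_on with
  | C1 => rw [map_one]; exact one_mem _
  | of j => exact Subgroup.subset_closure (hX j)
  | inv_of j h => rw [map_inv]; exact inv_mem h
  | mul a b ha hb => rw [map_mul]; exact mul_mem ha hb

theorem gen_XX (hπ : ∀ i, Function.Surjective (π i)) (i : ℕ) : Generates (XX n π i) :=
  gen_image (π i) (hπ i) _ (fun j => by simp [XX])

theorem gen_YY : Generates (YY n π) :=
  gen_image (rho0 n π).rangeRestrict (rho0 n π).rangeRestrict_surjective _ (fun j => by simp [YY])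

theorem fac_cases (i : ℕ) (b : Bool) (N : ℕ) (m : ℤ) :
    fac (yv n π i) b N m = 1 ∨ fac (yv n π i) b N m ∈ XX n π i ∨
      (fac (yv n π i) b N m)⁻¹ ∈ XX n π i := by
  have h : yv n π i N = 1 ∨ yv n π i N ∈ XX n π i := by
    rcases yv_cases n π i N with h | ⟨j, h⟩
    · exact Or.inl h
    · right; rw [h]; simp [XX]
  unfold fac
  rcases h with h | h <;> split_ifs <;> simp [h]

theorem U_length (i : ℕ) (w : List (Fin 2 × Bool)) (k m : ℤ) :
    ∃ v : List (G i), v.length ≤ w.length ∧ (∀ a ∈ v, a ∈ XX n π i ∨ a⁻¹ ∈ XX n π i) ∧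
      v.prod = U (yv n π i) w k m := by
  induction w with
  | nil => exact ⟨[], by simp, by simp, by simp [U]⟩
  | cons l w ih =>
    obtain ⟨v, h1, h2, h3⟩ := ih
    have key : ∀ z : G i, (z = 1 ∨ z ∈ XX n π i ∨ z⁻¹ ∈ XX n π i) →
        ∃ v : List (G i), v.length ≤ w.length + 1 ∧ (∀ a ∈ v, a ∈ XX n π i ∨ a⁻¹ ∈ XX n π i) ∧
        v.prod = z * U (yv n π i) w k m := by
      rintro z (rfl | hz)
      · exact ⟨v, by omega, h2, by simp [h3]⟩
      · refine ⟨z :: v, by simpa using h1, ?_, by simp [h3]⟩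
        intro a ha
        rcases List.mem_cons.1 ha with rfl | ha
        · exact hz
        · exact h2 a ha
    simp only [U, List.length_cons]
    apply key
    split_ifs
    · exact fac_cases n π i _ _ _
    · exact Or.inl rfl

theorem YY_word (u : List (rho0 n π).range) (h : ∀ a ∈ u, a ∈ YY n π ∨ a⁻¹ ∈ YY n π) :
    ∃ w : List (Fin 2 × Bool), w.length = u.length ∧
      (rho0 n π).rangeRestrict (FreeGroup.mk w) = u.prod := by
  induction u with
  | nil => exact ⟨[], rfl, by rw [← FreeGroup.one_eq_mk, map_one]; rfl⟩
  | cons a u ih =>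
    obtain ⟨w, h1, h2⟩ := ih (fun b hb => h b (List.mem_cons_of_mem _ hb))
    have : ∃ l : Fin 2 × Bool, (rho0 n π).rangeRestrict (FreeGroup.mk [l]) = a := by
      rcases h a List.mem_cons_self with h | h
      · simp only [YY, Finset.mem_image] at h
        obtain ⟨j, -, h⟩ := h
        exact ⟨(j, true), h⟩
      · simp only [YY, Finset.mem_image] at h
        obtain ⟨j, -, h⟩ := h
        refine ⟨(j, false), ?_⟩
        rw [← inv_inv a, ← h, ← map_inv]
        rfl
    obtain ⟨l, hl⟩ := this
    refine ⟨l :: w, by simp [h1], ?_⟩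
    rw [List.prod_cons, ← hl, ← h2, ← map_mul, FreeGroup.mul_mk]
    rfl

theorem phi_QI (hπ : ∀ i, Function.Surjective (π i)) (i : ℕ) :
    IsQIEmbedding (XX n π i) (YY n π) (phi n π hπ i) := by
  refine ⟨phi_injective n π hπ i, ?_⟩
  obtain ⟨C, hC, h⟩ := wordLength_hom (XX n π i) (YY n π) (gen_XX n π hπ i) (gen_YY n π)
    (phi n π hπ i)
  have hC1 : (1 : ℝ) ≤ C := by exact_mod_cast hC
  refine ⟨C, 1, by linarith, one_pos, fun g => ⟨?_, ?_⟩⟩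
  · have h1 : wordLength (XX n π i) g ≤ wordLength (YY n π) (phi n π hπ i g) := by
      obtain ⟨u, hu1, hu2, hu3⟩ := wordLength_spec (YY n π) (gen_YY n π) (phi n π hπ i g)
      obtain ⟨w, hw1, hw2⟩ := YY_word n π u hu2
      obtain ⟨v, hv1, hv2, hv3⟩ := U_length n π i w 1 0
      have hg : v.prod = g := by
        have e : rho0 n π (FreeGroup.mk w) = Phi G i g := by
          rw [← phi_val n π hπ, ← hu3, ← hw2]
          rfl
        have e2 := DFunLike.congr_fun (congrFun e i) ((1 : ℤ), (0 : ℤ), (1 : G i))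
        rw [rho0_apply, act_mk, Phi_same, dl_apply, if_pos ⟨rfl, rfl⟩] at e2
        simp only [Prod.mk.injEq, mul_one] at e2
        rw [hv3, e2.2.2]
      rw [← hu1, ← hw1, ← hg]
      exact (wordLength_le _ v hv2).trans hv1
    have h2 : (wordLength (XX n π i) g : ℝ) ≤ wordLength (YY n π) (phi n π hπ i g) := by
      exact_mod_cast h1
    have h3 : (1 / (C : ℝ)) * (wordLength (XX n π i) g : ℝ) ≤ 1 * wordLength (XX n π i) g := by
      apply mul_le_mul_of_nonneg_right _ (Nat.cast_nonneg _)
      rw [div_le_one (by linarith)]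
      exact hC1
    linarith
  · have : (wordLength (YY n π) (phi n π hπ i g) : ℝ) ≤ C * wordLength (XX n π i) g := by
      exact_mod_cast h g
    linarith

end family2
end FamEmb
namespace FamEmb

/-- States of the symbolic machine. -/
abbrev St := (ℕ × ℕ) × (ℕ × ℕ) × List (ℕ × Bool)

/-- One step of the symbolic machine. -/
def step (q : ℕ × ℕ) (l : Fin 2 × Bool) (s : St) : St :=
  if l.1 = 0 then (if l.2 = true then (s.1.1 + 1, s.1.2) else (s.1.1, s.1.2 + 1), s.2)
  else if On (s.1.1 - s.1.2) then
    (s.1, if l.2 = true then (s.2.1.1 + 1, s.2.1.2) else (s.2.1.1, s.2.1.2 + 1),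
      if s.2.1.2 + (if l.2 = true then 0 else 1) ≤ s.2.1.1 then
        emt q.1 q.2 (s.1.1 - s.1.2) l.2 ++ s.2.2 else s.2.2)
  else s

/-- The symbolic machine. -/
def run (q : ℕ × ℕ) (w : List (Fin 2 × Bool)) (s : St) : St := w.foldr (step q) s

section prim
open Primrec

theorem prim_pow : Primrec fun k : ℕ => 2 ^ k := by
  refine (nat_rec₁ (f := fun _ r => r * 2) 1 ?_).of_eq ?_
  · exact (nat_mul.comp snd (const 2)).to₂
  · intro k
    induction k with
    | zero => rfl
    | succ k ih => rw [pow_succ, ← ih]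

theorem prim_lg : Primrec lg := by
  unfold lg
  exact nat_findGreatest (p := fun N k => 2 ^ k ≤ N) Primrec.id
    (PrimrecRel.comp nat_le (prim_pow.comp snd) fst)

theorem prim_On : PrimrecPred On := by
  unfold On
  exact PrimrecRel.comp Primrec.eq (prim_pow.comp prim_lg) Primrec.id

theorem prim_emt : Primrec fun t : (ℕ × ℕ) × ℕ × Bool => emt t.1.1 t.1.2 t.2.1 t.2.2 := by
  unfold emt
  have hl : Primrec fun t : (ℕ × ℕ) × ℕ × Bool => lg t.2.1 := prim_lg.comp (fst.comp snd)
  have hu : Primrec fun t : (ℕ × ℕ) × ℕ × Bool => Nat.unpair (lg t.2.1 - 1) :=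
    Primrec.unpair.comp (nat_sub.comp hl (const 1))
  refine Primrec.ite ?_ ?_ (const [])
  · refine PrimrecPred.and ?_ (PrimrecPred.and ?_ ?_)
    · exact PrimrecPred.not (PrimrecRel.comp Primrec.eq hl (const 0))
    · exact PrimrecRel.comp Primrec.eq (fst.comp hu) (snd.comp fst)
    · exact PrimrecRel.comp nat_lt (snd.comp hu) (fst.comp fst)
  · exact list_cons.comp (Primrec.pair (snd.comp hu) (snd.comp snd)) (const [])

theorem prim_step : Primrec fun t : (ℕ × ℕ) × (Fin 2 × Bool) × St => step t.1 t.2.1 t.2.2 := by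
  unfold step
  have hl1 : Primrec fun t : (ℕ × ℕ) × (Fin 2 × Bool) × St => t.2.1.1 := fst.comp (fst.comp snd)
  have hl2 : Primrec fun t : (ℕ × ℕ) × (Fin 2 × Bool) × St => t.2.1.2 := snd.comp (fst.comp snd)
  have hs : Primrec fun t : (ℕ × ℕ) × (Fin 2 × Bool) × St => t.2.2 := snd.comp snd
  have ha : Primrec fun t : (ℕ × ℕ) × (Fin 2 × Bool) × St => t.2.2.1.1 := fst.comp (fst.comp hs)
  have hb : Primrec fun t : (ℕ × ℕ) × (Fin 2 × Bool) × St => t.2.2.1.2 := snd.comp (fst.comp hs)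
  have hc : Primrec fun t : (ℕ × ℕ) × (Fin 2 × Bool) × St => t.2.2.2.1.1 :=
    fst.comp (fst.comp (snd.comp hs))
  have hd : Primrec fun t : (ℕ × ℕ) × (Fin 2 × Bool) × St => t.2.2.2.1.2 :=
    snd.comp (fst.comp (snd.comp hs))
  have hv : Primrec fun t : (ℕ × ℕ) × (Fin 2 × Bool) × St => t.2.2.2.2 :=
    snd.comp (snd.comp hs)
  have hp : PrimrecPred fun t : (ℕ × ℕ) × (Fin 2 × Bool) × St => t.2.1.2 = true :=
    PrimrecRel.comp Primrec.eq hl2 (const true)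
  have hN : Primrec fun t : (ℕ × ℕ) × (Fin 2 × Bool) × St => t.2.2.1.1 - t.2.2.1.2 :=
    nat_sub.comp ha hb
  refine Primrec.ite (PrimrecRel.comp Primrec.eq hl1 (const 0)) ?_ (Primrec.ite ?_ ?_ hs)
  · exact Primrec.pair (Primrec.ite hp (Primrec.pair (succ.comp ha) hb)
      (Primrec.pair ha (succ.comp hb))) (snd.comp hs)
  · exact prim_On.comp hN
  · refine Primrec.pair (fst.comp hs) (Primrec.pair (Primrec.ite hp
      (Primrec.pair (succ.comp hc) hd) (Primrec.pair hc (succ.comp hd))) (Primrec.ite ?_ ?_ hv))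
    · exact PrimrecRel.comp nat_le (nat_add.comp hd (Primrec.ite hp (const 0) (const 1))) hc
    · exact list_append.comp (prim_emt.comp (Primrec.pair fst (Primrec.pair hN hl2))) hv

theorem prim_run : Primrec fun t : (ℕ × ℕ) × List (Fin 2 × Bool) × St => run t.1 t.2.1 t.2.2 := by
  unfold run
  exact list_foldr (h := fun (t : (ℕ × ℕ) × List (Fin 2 × Bool) × St)
      (p : (Fin 2 × Bool) × St) => step t.1 p.1 p.2) (fst.comp snd) (snd.comp snd)
    (prim_step.comp (Primrec.pair (fst.comp fst) snd))

theorem prim_bd : Primrec bd := by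
  unfold bd
  exact prim_pow.comp (nat_add.comp list_length (const 4))

end prim

theorem comp_ball {α : Type} [Primcodable α] {f : α → ℕ} (hf : Computable f)
    {p : α × ℕ → Prop} (hp : ComputablePred p) :
    ComputablePred fun a => ∀ k < f a, p (a, k) := by
  classical
  have h : Computable fun a => (f a).rec (motive := fun _ => Bool) true
      (fun k r => r && decide (p (a, k))) :=
    Computable.nat_rec hf (Computable.const true)
      (h := fun (a : α) (t : ℕ × Bool) => t.2 && decide (p (a, t.1)))
      (Primrec.and.to_comp.comp (Computable.snd.comp Computable.snd)
        (hp.decide.comp (Computable.pair Computable.fst (Computable.fst.comp Computable.snd))))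
  apply Computable.computablePred
  refine h.of_eq fun a => ?_
  induction f a with
  | zero => simp
  | succ k ih =>
    simp only [ih, Nat.lt_succ_iff_lt_or_eq, ← Bool.decide_and]
    congr 1
    apply propext
    constructor
    · rintro ⟨h1, h2⟩ j (hj | rfl)
      · exact h1 j hj
      · exact h2
    · intro h
      exact ⟨fun j hj => h j (Or.inl hj), h k (Or.inr rfl)⟩

theorem comp_and {α : Type} [Primcodable α] {p q : α → Prop} (hp : ComputablePred p)
    (hq : ComputablePred q) : ComputablePred fun a => p a ∧ q a := by
  classical
  apply Computable.computablePred
  exact (Primrec.and.to_comp.comp hp.decide hq.decide).of_eq fun a => by simp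

theorem comp_or {α : Type} [Primcodable α] {p q : α → Prop} (hp : ComputablePred p)
    (hq : ComputablePred q) : ComputablePred fun a => p a ∨ q a := by
  classical
  apply Computable.computablePred
  exact (Primrec.or.to_comp.comp hp.decide hq.decide).of_eq fun a => by simp

theorem comp_comp {α β : Type} [Primcodable α] [Primcodable β] {p : β → Prop}
    (hp : ComputablePred p) {f : α → β} (hf : Computable f) : ComputablePred fun a => p (f a) := by
  classical
  apply Computable.computablePred
  exact hp.decide.comp hf

section family
variable (n : ℕ → ℕ) {G : ℕ → Type} [∀ i, Group (G i)]
    (π : ∀ i, FreeGroup (Fin (n i)) →* G i)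

/-- Meaning of a symbolic state. -/
def dec (i : ℕ) (s : St) : ℤ × ℤ × G i :=
  ((s.1.1 : ℤ) - s.1.2, (s.2.1.1 : ℤ) - s.2.1.2, evalWord (xv n π i) s.2.2)

theorem dec_step (i : ℕ) (l : Fin 2 × Bool) (s : St) :
    dec n π i (step (n i, i) l s) = letterPerm (yv n π i) l (dec n π i s) := by
  obtain ⟨⟨a, b⟩, ⟨c, d⟩, v⟩ := s
  obtain ⟨k, e⟩ := l
  rw [dec, dec, letterPerm_apply]
  have hN : ((a : ℤ) - b).toNat = a - b := by omega
  have hk : k = 0 ∨ k ≠ 0 := em _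
  simp only [hN, step]
  rcases hk with rfl | hk
  · cases e
    · simp [sg]; ring
    · simp [sg]; ring
  · obtain rfl : k = 1 := by omega
    by_cases ho : On (a - b)
    · cases e
      · by_cases h : d + 1 ≤ c
        · have h' : (0 : ℤ) ≤ c - d - 1 := by omega
          have h1 : (1 : ℤ) ≤ c - d := by omega
          have h2 : d < c := by omega
          simp [ho, h2, sg, fac, evalWord_append, evalWord_emt_false, yv, h1]
          ring
        · have h1 : ¬ (1 : ℤ) ≤ c - d := by omega
          have h2 : ¬ d < c := by omega
          simp [ho, h2, sg, fac, h1]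
          ring
      · by_cases h : d ≤ c
        · simp [ho, h, sg, fac, evalWord_append, yv]
          ring
        · simp [ho, h, sg, fac]
          ring
    · simp [ho]

theorem dec_run (i : ℕ) (w : List (Fin 2 × Bool)) (s : St) :
    dec n π i (run (n i, i) w s) = act (yv n π i) (FreeGroup.mk w) (dec n π i s) := by
  induction w with
  | nil => simp [run, act_nil]
  | cons l w ih =>
    rw [act_cons, Equiv.Perm.mul_apply, ← ih, ← dec_step]
    rfl

theorem run_lt (q : ℕ × ℕ) (w : List (Fin 2 × Bool)) (s : St) (h : ∀ p ∈ s.2.2, p.1 < q.1) :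
    ∀ p ∈ (run q w s).2.2, p.1 < q.1 := by
  induction w with
  | nil => exact h
  | cons l w ih =>
    change ∀ p ∈ (step q l (run q w s)).2.2, p.1 < q.1
    unfold step
    split_ifs <;> try exact ih
    all_goals
      intro p hp
      rcases List.mem_append.1 hp with hp | hp
      · exact emt_lt _ _ _ _ p hp
      · exact ih p hp

theorem P_iff (P : ℕ × List (ℕ × Bool) → Prop)
    (hPc : ∀ i (w : List (Fin (n i) × Bool)),
      P (i, w.map (fun p => ((p.1 : ℕ), p.2))) ↔ π i (FreeGroup.mk w) = 1)
    (i : ℕ) (v : List (ℕ × Bool)) (hv : ∀ p ∈ v, p.1 < n i) :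
    P (i, v) ↔ evalWord (xv n π i) v = 1 := by
  obtain ⟨w, rfl⟩ : ∃ w : List (Fin (n i) × Bool), w.map (fun p => ((p.1 : ℕ), p.2)) = v := by
    clear hPc
    induction v with
    | nil => exact ⟨[], rfl⟩
    | cons p v ih =>
      obtain ⟨w, hw⟩ := ih (fun a ha => hv a (List.mem_cons_of_mem _ ha))
      exact ⟨(⟨p.1, hv p List.mem_cons_self⟩, p.2) :: w, by simp [hw]⟩
  rw [hPc]
  have : evalWord (xv n π i) (w.map (fun p => ((p.1 : ℕ), p.2))) = π i (FreeGroup.mk w) := by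
    have e : π i = FreeGroup.lift (fun j => π i (FreeGroup.of j)) := by
      apply FreeGroup.ext_hom; intro j; simp
    rw [e, FreeGroup.lift_mk, evalWord, List.map_map]
    congr 1
    apply List.map_congr_left
    rintro ⟨j, b⟩ -
    cases b <;> simp [xv]
  rw [this]

/-- The test at one point. The argument is `(((((w, i), a), b), c), d)`. -/
def test (P : ℕ × List (ℕ × Bool) → Prop) (E : ℕ)
    (t : ((((List (Fin 2 × Bool) × ℕ) × ℕ) × ℕ) × ℕ) × ℕ) : Prop :=
  ((run (n t.1.1.1.1.2, t.1.1.1.1.2) t.1.1.1.1.1 ((t.1.1.1.2, t.1.1.2), (t.1.2, t.2), [])).1.1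
      + t.1.1.2 =
    t.1.1.1.2 +
    (run (n t.1.1.1.1.2, t.1.1.1.1.2) t.1.1.1.1.1 ((t.1.1.1.2, t.1.1.2), (t.1.2, t.2), [])).1.2 ∧
  (run (n t.1.1.1.1.2, t.1.1.1.1.2) t.1.1.1.1.1 ((t.1.1.1.2, t.1.1.2), (t.1.2, t.2), [])).2.1.1
      + t.2 = t.1.2 +
    (run (n t.1.1.1.1.2, t.1.1.1.1.2) t.1.1.1.1.1
      ((t.1.1.1.2, t.1.1.2), (t.1.2, t.2), [])).2.1.2) ∧
  ((t.1.1.1.1.2 + 1 = E ∧ t.1.1.1.2 = t.1.1.2 + 1 ∧ t.1.2 = t.2) ∨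
    P (t.1.1.1.1.2, (run (n t.1.1.1.1.2, t.1.1.1.1.2) t.1.1.1.1.1
      ((t.1.1.1.2, t.1.1.2), (t.1.2, t.2), [])).2.2))

theorem test_iff (P : ℕ × List (ℕ × Bool) → Prop)
    (hPc : ∀ i (w : List (Fin (n i) × Bool)),
      P (i, w.map (fun p => ((p.1 : ℕ), p.2))) ↔ π i (FreeGroup.mk w) = 1)
    (E : ℕ) (w : List (Fin 2 × Bool)) (i a b c d : ℕ) :
    test n P E (((((w, i), a), b), c), d) ↔
      sexp w = 0 ∧ disp w ((a : ℤ) - b) = 0 ∧ ((i + 1 = E ∧ a = b + 1 ∧ c = d) ∨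
        U (yv n π i) w ((a : ℤ) - b) ((c : ℤ) - d) = 1) := by
  have h1 := dec_run n π i w ((a, b), (c, d), [])
  have h2 := run_lt (n i, i) w ((a, b), (c, d), []) (by simp)
  unfold test
  dsimp only
  generalize run (n i, i) w ((a, b), (c, d), []) = r at h1 h2
  rw [P_iff n π P hPc i _ h2]
  simp only [dec, act_mk, evalWord_nil, Prod.mk.injEq, mul_one] at h1
  obtain ⟨e1, e2, e3⟩ := h1
  rw [e3, and_assoc]
  refine and_congr ?_ (and_congr ?_ Iff.rfl) <;> omega

theorem test_comp_aux {T : Type} [Primcodable T] (P : ℕ × List (ℕ × Bool) → Prop)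
    (hP : ComputablePred P) (E : ℕ) (r : T → St) (hr : Computable r) (i a b c d : T → ℕ)
    (hi : Computable i) (ha : Computable a) (hb : Computable b) (hc : Computable c)
    (hd : Computable d) :
    ComputablePred fun t => ((r t).1.1 + b t = a t + (r t).1.2 ∧
      (r t).2.1.1 + d t = c t + (r t).2.1.2) ∧
      ((i t + 1 = E ∧ a t = b t + 1 ∧ c t = d t) ∨ P (i t, (r t).2.2)) := by
  have heq : ComputablePred fun z : ℕ × ℕ => z.1 = z.2 :=
    PrimrecPred.computablePred (PrimrecRel.comp Primrec.eq Primrec.fst Primrec.snd)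
  have hadd : Computable fun z : ℕ × ℕ => z.1 + z.2 := Primrec.nat_add.to_comp
  refine comp_and (comp_and ?_ ?_) (comp_or (comp_and ?_ (comp_and ?_ ?_)) ?_)
  · exact comp_comp heq (Computable.pair
      (hadd.comp (Computable.pair (Computable.fst.comp (Computable.fst.comp hr)) hb))
      (hadd.comp (Computable.pair ha (Computable.snd.comp (Computable.fst.comp hr)))))
  · exact comp_comp heq (Computable.pair
      (hadd.comp (Computable.pair
        (Computable.fst.comp (Computable.fst.comp (Computable.snd.comp hr))) hd))
      (hadd.comp (Computable.pair hc
        (Computable.snd.comp (Computable.fst.comp (Computable.snd.comp hr))))))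
  · exact comp_comp heq (Computable.pair (Computable.succ.comp hi) (Computable.const E))
  · exact comp_comp heq (Computable.pair ha (Computable.succ.comp hb))
  · exact comp_comp heq (Computable.pair hc hd)
  · exact comp_comp hP (Computable.pair hi (Computable.snd.comp (Computable.snd.comp hr)))

/-- Abstract composition lemma, stated for arbitrary types so that nothing is unfolded. -/
theorem abs_comp {T A B S R : Type} [Primcodable T] [Primcodable A] [Primcodable B]
    [Primcodable S] [Primcodable R] (F : A → B → S → R)
    (hF : Computable fun t : A × B × S => F t.1 t.2.1 t.2.2)
    (q : T → A) (hq : Computable q) (w : T → B) (hw : Computable w) (s : T → S)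
    (hs : Computable s) : Computable fun t => F (q t) (w t) (s t) :=
  hF.comp (Computable.pair hq (Computable.pair hw hs))

theorem abs_pair {T A B C D E : Type} [Primcodable T] [Primcodable A] [Primcodable B]
    [Primcodable C] [Primcodable D] [Primcodable E] (a : T → A) (b : T → B) (c : T → C)
    (d : T → D) (e : E) (ha : Computable a) (hb : Computable b) (hc : Computable c)
    (hd : Computable d) : Computable fun t => ((a t, b t), (c t, d t), e) :=
  Computable.pair (Computable.pair ha hb) (Computable.pair (Computable.pair hc hd)
    (Computable.const e))

theorem run_comp {T : Type} [Primcodable T] (hn : Computable n)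
    (w : T → List (Fin 2 × Bool)) (hw : Computable w) (i a b c d : T → ℕ)
    (hi : Computable i) (ha : Computable a) (hb : Computable b) (hc : Computable c)
    (hd : Computable d) :
    Computable fun t => run (n (i t), i t) (w t) ((a t, b t), (c t, d t), []) :=
  abs_comp run prim_run.to_comp (fun t => (n (i t), i t)) (Computable.pair (hn.comp hi) hi) w hw
    (fun t => ((a t, b t), (c t, d t), [])) (abs_pair a b c d [] ha hb hc hd)

theorem test_comp (hn : Computable n) (P : ℕ × List (ℕ × Bool) → Prop) (hP : ComputablePred P)
    (E : ℕ) : ComputablePred (test n P E) := by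
  have q1 := Computable.fst (α := (((List (Fin 2 × Bool) × ℕ) × ℕ) × ℕ) × ℕ) (β := ℕ)
  have hd := Computable.snd (α := (((List (Fin 2 × Bool) × ℕ) × ℕ) × ℕ) × ℕ) (β := ℕ)
  have hc := Computable.snd.comp q1
  have q2 := Computable.fst.comp q1
  have hb := Computable.snd.comp q2
  have q3 := Computable.fst.comp q2
  have ha := Computable.snd.comp q3
  have q4 := Computable.fst.comp q3
  have hi := Computable.snd.comp q4
  have hw := Computable.fst.comp q4
  exact test_comp_aux P hP E _ (run_comp n hn _ hw _ _ _ _ _ hi ha hb hc hd) _ _ _ _ _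
    hi ha hb hc hd

theorem good_comp (hn : Computable n) (P : ℕ × List (ℕ × Bool) → Prop) (hP : ComputablePred P)
    (hPc : ∀ i (w : List (Fin (n i) × Bool)),
      P (i, w.map (fun p => ((p.1 : ℕ), p.2))) ↔ π i (FreeGroup.mk w) = 1) (E : ℕ) :
    ComputablePred fun w => Good (yv n π) w E := by
  have hbd : Computable bd := prim_bd.to_comp
  have h := test_comp n hn P hP E
  have f1 := hbd
  have f2 := f1.comp (Computable.fst (α := List (Fin 2 × Bool)) (β := ℕ))
  have f3 := f2.comp (Computable.fst (α := List (Fin 2 × Bool) × ℕ) (β := ℕ))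
  have f4 := f3.comp (Computable.fst (α := (List (Fin 2 × Bool) × ℕ) × ℕ) (β := ℕ))
  have f5 := f4.comp (Computable.fst (α := ((List (Fin 2 × Bool) × ℕ) × ℕ) × ℕ) (β := ℕ))
  have h6 := comp_ball f1 (comp_ball f2 (comp_ball f3 (comp_ball f4 (comp_ball f5 h))))
  refine h6.of_eq fun w => ⟨fun H => ?_, fun H => ?_⟩
  · apply reduction (yv n π) (yv_large n π)
    intro i hi a ha b hb c hc d hd
    exact (test_iff n π P hPc E w i a b c d).1 (H i hi a ha b hb c hc d hd)
  · intro i _ a _ b _ c _ d _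
    rw [test_iff n π P hPc]
    obtain ⟨h1, h2, h3⟩ := H
    refine ⟨h1, h2 _, (h3 i ((a : ℤ) - b) ((c : ℤ) - d)).imp ?_ id⟩
    rintro ⟨e1, e2, e3⟩
    exact ⟨e1, by omega, by omega⟩

end family
end FamEmb

theorem family_word_problem_embedding_into_two_generated
    (n : ℕ → ℕ) (hn : Computable n)
    (G : ℕ → Type) [∀ i, Group (G i)]
    (π : ∀ i, FreeGroup (Fin (n i)) →* G i) (hπ : ∀ i, Function.Surjective (π i))
    (P : ℕ × List (ℕ × Bool) → Prop) (hP : ComputablePred P)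
    (hPc : ∀ i (w : List (Fin (n i) × Bool)),
      P (i, w.map (fun p => ((p.1 : ℕ), p.2))) ↔ π i (FreeGroup.mk w) = 1) :
    ∃ (H : Type) (_ : Group H) (ρ : FreeGroup (Fin 2) →* H),
      Function.Surjective ρ ∧ DecidableWordProblemVia ρ ∧
      ∀ i, ∃ (X : Finset (G i)) (Y : Finset H) (φ : G i →* H),
        Generates X ∧ Generates Y ∧ IsQIEmbedding X Y φ ∧ IsFrattini φ ∧
        DecidableMembership ρ φ := by
  refine ⟨(FamEmb.rho0 n π).range, inferInstance, (FamEmb.rho0 n π).rangeRestrict,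
    (FamEmb.rho0 n π).rangeRestrict_surjective, ?_, fun i => ?_⟩
  · refine (FamEmb.good_comp n π hn P hP hPc 0).of_eq fun w => ?_
    rw [← FamEmb.rho0_mk_eq_one_iff]
    exact ⟨fun h => Subtype.ext h, fun h => congrArg Subtype.val h⟩
  · refine ⟨FamEmb.XX n π i, FamEmb.YY n π, FamEmb.phi n π hπ i, FamEmb.gen_XX n π hπ i,
      FamEmb.gen_YY n π, FamEmb.phi_QI n π hπ i, FamEmb.phi_frattini n π hπ i, ?_⟩
    refine (FamEmb.good_comp n π hn P hP hPc (i + 1)).of_eq fun w => ?_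
    rw [← FamEmb.rho0_mk_mem_iff, MonoidHom.mem_range]
    exact exists_congr fun g => ⟨fun h => Subtype.ext h, fun h => congrArg Subtype.val h⟩
end
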